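/- Let a₁ be a nonzero integer, A a nonzero rational number, and δ ∈ (0,1). Then there is a constant C = C(a₁, A, δ) such that for all real P ≥ 2, all R with 2 ≤ R ≤ P, and all λ ∈ ℝ one has J(λ;A) = ∫_𝔐 |g(a₁θ)|^{9/4} |h(Aθ + λ; P,R)|⁴ dθ ≤ C·P^{9/4}. -/

import Mathlib

open scoped Real
open Filter MeasureTheory

noncomputable section

/-- `e(z) = exp(2πiz)`. -/
def e (z : ℝ) : ℂ := Complex.exp (2 * Real.pi * Complex.I * z)

/-- The set `𝒜(P,R)` of `R`-smooth positive integers not exceeding `P`. -/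
def smoothA (P R : ℝ) : Finset ℕ :=
  (Finset.Icc 1 ⌊P⌋₊).filter (fun n => ∀ p ∈ n.primeFactors, (p : ℝ) ≤ R)

/-- The smooth Weyl sum `h(α; P, R)`. -/
def h (P R α : ℝ) : ℂ := ∑ x ∈ smoothA P R, e (α * (x : ℝ) ^ 4)

/-- `Δ₇ = 0.849408`. -/
def Δ₇ : ℝ := 0.849408

/-- `Δ₁₀ = 0.213431`. -/
def Δ₁₀ : ℝ := 0.213431

/-- The classical Weyl sum `g(θ) = Σ_{δP < x ≤ P} e(θx⁴)`. -/
def g (δ P θ : ℝ) : ℂ :=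
  ∑ x ∈ (Finset.Icc 1 ⌊P⌋₊).filter (fun x : ℕ => δ * P < (x : ℝ)), e (θ * (x : ℝ) ^ 4)

/-- The one-dimensional major arcs `𝔐`: the union of
`𝔐(q,a) = {α ∈ [0,1) : |qα − a| ≤ P^{−7/2}}` over `0 ≤ a ≤ q ≤ P^{1/2}`, `gcd(a,q) = 1`. -/
def majM (P : ℝ) : Set ℝ :=
  {α | α ∈ Set.Ico (0:ℝ) 1 ∧ ∃ q a : ℕ, 1 ≤ q ∧ (q : ℝ) ≤ P ^ ((1:ℝ)/2) ∧ a ≤ q ∧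
    Nat.gcd a q = 1 ∧ |(q : ℝ) * α - (a : ℝ)| ≤ P ^ (-(7:ℝ)/2)}

/-- The number of pairs of residues modulo `q` with equal fourth powers. -/
def quarticPairs (q : ℕ) : ℕ := Nat.card {p : ZMod q × ZMod q // p.1 ^ 4 = p.2 ^ 4}

/-- The number of fourth roots of unity modulo `q`. -/
def quarticRoots (q : ℕ) : ℕ := Nat.card {u : (ZMod q)ˣ // u ^ 4 = 1}

/-- A multiplicative majorant for the square of a normalised complete quartic exponential sum. -/
def quarticWeight (q : ℕ) : ℝ :=
  (quarticPairs q : ℝ) * quarticRoots q / (q * q.totient)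

lemma quarticPairs_mul {m n : ℕ} (hmn : m.Coprime n) :
    quarticPairs (m * n) = quarticPairs m * quarticPairs n := by
  unfold quarticPairs
  rw [← Nat.card_prod]
  let E := ZMod.chineseRemainder hmn
  refine Nat.card_congr
    { toFun := fun p => (⟨((E p.1.1).1, (E p.1.2).1), ?_⟩, ⟨((E p.1.1).2, (E p.1.2).2), ?_⟩)
      invFun := fun p => ⟨(E.symm (p.1.1.1, p.2.1.1), E.symm (p.1.1.2, p.2.1.2)), ?_⟩
      left_inv := ?_
      right_inv := ?_ }
  · have := congrArg E p.2
    simp only [map_pow] at this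
    exact congrArg Prod.fst this
  · have := congrArg E p.2
    simp only [map_pow] at this
    exact congrArg Prod.snd this
  · apply E.injective
    simp only [map_pow, RingEquiv.apply_symm_apply]
    exact Prod.ext p.1.2 p.2.2
  · rintro ⟨⟨x, y⟩, hxy⟩
    simp
  · rintro ⟨⟨⟨x, y⟩, hxy⟩, ⟨⟨z, w⟩, hzw⟩⟩
    simp

lemma quarticRoots_mul {m n : ℕ} (hmn : m.Coprime n) :
    quarticRoots (m * n) = quarticRoots m * quarticRoots n := by
  unfold quarticRoots
  rw [← Nat.card_prod]
  let E := (Units.mapEquiv (ZMod.chineseRemainder hmn).toMulEquiv).trans MulEquiv.prodUnits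
  refine Nat.card_congr
    { toFun := fun p => (⟨(E p.1).1, ?_⟩, ⟨(E p.1).2, ?_⟩)
      invFun := fun p => ⟨E.symm (p.1.1, p.2.1), ?_⟩
      left_inv := ?_
      right_inv := ?_ }
  · have := congrArg E p.2
    simp only [map_pow, map_one] at this
    exact congrArg Prod.fst this
  · have := congrArg E p.2
    simp only [map_pow, map_one] at this
    exact congrArg Prod.snd this
  · apply E.injective
    simp only [map_pow, map_one, MulEquiv.apply_symm_apply]
    exact Prod.ext p.1.2 p.2.2
  · rintro ⟨x, hx⟩
    simp
  · rintro ⟨⟨x, hx⟩, ⟨z, hz⟩⟩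
    simp

lemma quarticWeight_mul {m n : ℕ} (hmn : m.Coprime n) :
    quarticWeight (m * n) = quarticWeight m * quarticWeight n := by
  unfold quarticWeight
  rw [quarticPairs_mul hmn, quarticRoots_mul hmn, Nat.totient_mul hmn, div_mul_div_comm]
  push_cast
  congr 1 <;> ring

lemma quarticPairs_one : quarticPairs 1 = 1 := by
  unfold quarticPairs
  rw [Nat.card_eq_one_iff_unique]
  refine ⟨⟨fun a b => Subtype.ext ?_⟩, ⟨⟨(0, 0), rfl⟩⟩⟩
  exact Prod.ext (Subsingleton.elim (α := Fin 1) _ _) (Subsingleton.elim (α := Fin 1) _ _)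

lemma quarticRoots_one : quarticRoots 1 = 1 := by
  unfold quarticRoots
  rw [Nat.card_eq_one_iff_unique]
  refine ⟨⟨fun a b => Subtype.ext (Units.ext ?_)⟩, ⟨⟨1, one_pow _⟩⟩⟩
  exact Subsingleton.elim (α := Fin 1) _ _

lemma quarticWeight_one : quarticWeight 1 = 1 := by
  simp [quarticWeight, quarticPairs_one, quarticRoots_one]

lemma quarticWeight_nonneg (q : ℕ) : 0 ≤ quarticWeight q := by
  unfold quarticWeight
  positivity

lemma card_zmod_mul_eq_zero_le (q : ℕ) [NeZero q] (b : ℤ) (hb : b ≠ 0) :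
    (Finset.univ.filter fun z : ZMod q => (b : ZMod q) * z = 0).card ≤ b.natAbs := by
  refine le_trans (Finset.card_le_card ?_)
    (IsAddCyclic.card_nsmul_eq_zero_le (α := ZMod q) (n := b.natAbs) (by omega))
  intro z hz
  simp only [Finset.mem_filter, Finset.mem_univ, true_and] at hz ⊢
  rw [nsmul_eq_mul]
  rcases Int.natAbs_eq b with h | h
  · rw [h, Int.cast_natCast] at hz
    exact hz
  · rw [h] at hz
    rw [Int.cast_neg, Int.cast_natCast, neg_mul, neg_eq_zero] at hz
    exact hz

lemma pow_dvd_two_mul_or {p : ℕ} (hp : p.Prime) (k : ℕ) {s t w : ℤ} (hst : t - s = 2 * w)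
    (hw : ¬ (p : ℤ) ∣ w) (hd : (p : ℤ) ^ k ∣ s * t) :
    (p : ℤ) ^ k ∣ 2 * s ∨ (p : ℤ) ^ k ∣ 2 * t := by
  have hpi : Prime (p : ℤ) := Nat.prime_iff_prime_int.1 hp
  have cop : ∀ z : ℤ, ¬ (p : ℤ) ∣ z → IsCoprime ((p : ℤ) ^ k) z := fun z hz =>
    (hpi.irreducible.coprime_iff_not_dvd.2 hz).pow_left
  by_cases hs : (p : ℤ) ∣ s
  · by_cases ht : (p : ℤ) ∣ t
    · have h2w : (p : ℤ) ∣ 2 * w := hst ▸ dvd_sub ht hs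
      have h2 : (p : ℤ) ∣ 2 := (hpi.dvd_or_dvd h2w).resolve_right hw
      have hp2 : p = 2 := (Nat.prime_dvd_prime_iff_eq hp Nat.prime_two).1 (by exact_mod_cast h2)
      subst hp2
      obtain ⟨s', rfl⟩ := hs
      obtain ⟨t', rfl⟩ := ht
      push_cast at *
      by_cases hs' : (2 : ℤ) ∣ s'
      · have ht' : ¬ (2 : ℤ) ∣ t' := by omega
        left
        refine (cop _ ht').dvd_of_dvd_mul_right ?_
        rwa [show 2 * (2 * s') * t' = 2 * s' * (2 * t') by ring]
      · right
        refine (cop _ hs').dvd_of_dvd_mul_right ?_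
        rwa [show 2 * (2 * t') * s' = 2 * s' * (2 * t') by ring]
    · left
      exact ((cop _ ht).dvd_of_dvd_mul_right hd).mul_left 2
  · right
    exact ((cop _ hs).dvd_of_dvd_mul_left hd).mul_left 2

lemma card_units_sq_eq_le {p : ℕ} (hp : p.Prime) (k : ℕ) [NeZero (p ^ k)]
    (c : (ZMod (p ^ k))ˣ) :
    (Finset.univ.filter fun y : (ZMod (p ^ k))ˣ => y ^ 2 = c).card ≤ 4 := by
  rcases (Finset.univ.filter fun y : (ZMod (p ^ k))ˣ => y ^ 2 = c).eq_empty_or_nonempty with h | h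
  · rw [h]; simp
  obtain ⟨y₀, hy₀⟩ := h
  simp only [Finset.mem_filter, Finset.mem_univ, true_and] at hy₀
  set Z := Finset.univ.filter fun z : ZMod (p ^ k) => ((2 : ℤ) : ZMod (p ^ k)) * z = 0 with hZ
  have hZc : Z.card ≤ 2 := card_zmod_mul_eq_zero_le (p ^ k) 2 (by norm_num)
  calc _ = ((Finset.univ.filter fun y : (ZMod (p ^ k))ˣ => y ^ 2 = c).image
        (fun y : (ZMod (p ^ k))ˣ => (y : ZMod (p ^ k)))).card :=
        (Finset.card_image_of_injective _ Units.val_injective).symm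
    _ ≤ (Z.image (fun z => z + (y₀ : ZMod (p ^ k))) ∪ Z.image (fun z => z - (y₀ : ZMod (p ^ k)))).card := by
        apply Finset.card_le_card
        intro x hx
        simp only [Finset.mem_image, Finset.mem_filter, Finset.mem_univ, true_and] at hx
        obtain ⟨y, hy, rfl⟩ := hx
        have hyy : (y : ZMod (p ^ k)) ^ 2 = (y₀ : ZMod (p ^ k)) ^ 2 := by
          have := congrArg Units.val (hy.trans hy₀.symm)
          simpa using this
        simp only [Finset.mem_union, Finset.mem_image, hZ, Finset.mem_filter, Finset.mem_univ,
          true_and]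
        suffices H : (2 : ZMod (p ^ k)) * (y - y₀) = 0 ∨ (2 : ZMod (p ^ k)) * (y + y₀) = 0 by
          rcases H with H | H
          · left; exact ⟨y - y₀, by simpa using H, by ring⟩
          · right; exact ⟨y + y₀, by simpa using H, by ring⟩
        rcases Nat.eq_zero_or_pos k with rfl | hk
        · left
          exact Subsingleton.elim (α := Fin 1) _ _
        have hdv : ∀ z : ℤ, ((p : ℤ) ^ k ∣ z) ↔ (z : ZMod (p ^ k)) = 0 := fun z => by
          rw [ZMod.intCast_zmod_eq_zero_iff_dvd]; push_cast; rfl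
        have hY : (((y : ZMod (p ^ k)).val : ℤ) : ZMod (p ^ k)) = y := by simp
        have hY₀ : (((y₀ : ZMod (p ^ k)).val : ℤ) : ZMod (p ^ k)) = y₀ := by simp
        have hw : ¬ (p : ℤ) ∣ ((y₀ : ZMod (p ^ k)).val : ℤ) := by
          intro hd
          have hd' : p ∣ (y₀ : ZMod (p ^ k)).val := by exact_mod_cast hd
          have hc := ZMod.val_coe_unit_coprime y₀
          have := Nat.Coprime.coprime_dvd_right (dvd_pow_self p hk.ne') hc
          have := Nat.Coprime.eq_one_of_dvd this.symm hd'
          exact hp.one_lt.ne' this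
        have := pow_dvd_two_mul_or hp k
          (s := ((y : ZMod (p ^ k)).val : ℤ) - ((y₀ : ZMod (p ^ k)).val : ℤ))
          (t := ((y : ZMod (p ^ k)).val : ℤ) + ((y₀ : ZMod (p ^ k)).val : ℤ)) (by ring) hw
          (by
            rw [hdv, Int.cast_mul, Int.cast_sub, Int.cast_add, hY, hY₀]
            linear_combination hyy)
        simpa only [hdv, Int.cast_mul, Int.cast_sub, Int.cast_add, hY, hY₀, Int.cast_ofNat]
          using this
    _ ≤ Z.card + Z.card := (Finset.card_union_le _ _).trans
        (add_le_add Finset.card_image_le Finset.card_image_le)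
    _ ≤ 4 := by omega

lemma card_units_pow_four_eq_le {p : ℕ} (hp : p.Prime) (k : ℕ) [NeZero (p ^ k)]
    (c : (ZMod (p ^ k))ˣ) :
    (Finset.univ.filter fun y : (ZMod (p ^ k))ˣ => y ^ 4 = c).card ≤ 16 := by
  have := Finset.card_le_mul_card_image_of_maps_to
    (s := Finset.univ.filter fun y : (ZMod (p ^ k))ˣ => y ^ 4 = c)
    (t := Finset.univ.filter fun y : (ZMod (p ^ k))ˣ => y ^ 2 = c) (f := fun y => y ^ 2)
    (by
      intro y hy
      simp only [Finset.mem_filter, Finset.mem_univ, true_and] at hy ⊢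
      rw [← hy]; group) 4
    (by
      intro b _
      refine le_trans (Finset.card_le_card ?_) (card_units_sq_eq_le hp k b)
      intro y hy
      simp only [Finset.mem_filter, Finset.mem_univ, true_and] at hy ⊢
      exact hy.2)
  have h2 := card_units_sq_eq_le hp k c
  omega

lemma quarticRoots_prime_pow_le {p : ℕ} (hp : p.Prime) (k : ℕ) : quarticRoots (p ^ k) ≤ 16 := by
  have : NeZero (p ^ k) := ⟨pow_ne_zero _ hp.ne_zero⟩
  unfold quarticRoots
  rw [Nat.card_eq_fintype_card, Fintype.card_subtype]
  exact card_units_pow_four_eq_le hp k 1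

lemma card_multiples_in_class_le {p k : ℕ} (hk : 1 ≤ k) [NeZero (p ^ k)]
    (a : ZMod (p ^ (k - 4))) :
    (Finset.univ.filter fun x : ZMod (p ^ k) =>
      p ∣ x.val ∧ ((x.val / p : ℕ) : ZMod (p ^ (k - 4))) = a).card ≤ p ^ (min 3 (k - 1)) := by
  have hsplit : p ^ k = p * (p ^ (k - 4) * p ^ (min 3 (k - 1))) := by
    rw [← pow_add, ← pow_succ']
    congr 1
    omega
  rw [← Finset.card_range (p ^ (min 3 (k - 1)))]
  apply Finset.card_le_card_of_injOn (fun x => x.val / p / p ^ (k - 4))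
  · intro x _
    simp only [Finset.coe_range, Set.mem_Iio]
    rw [Nat.div_div_eq_div_mul]
    apply Nat.div_lt_of_lt_mul
    rw [mul_assoc, ← hsplit]
    exact ZMod.val_lt x
  · intro x hx y hy hxy
    simp only [Finset.coe_filter, Finset.mem_univ, true_and, Set.mem_ofPred_eq] at hx hy hxy
    have hmod := (ZMod.natCast_eq_natCast_iff' _ _ _).1 (hx.2.trans hy.2.symm)
    have hq : x.val / p = y.val / p := by
      rw [← Nat.div_add_mod (x.val / p) (p ^ (k - 4)), ← Nat.div_add_mod (y.val / p) (p ^ (k - 4)),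
        hxy, hmod]
    apply ZMod.val_injective
    rw [← Nat.div_mul_cancel hx.1, ← Nat.div_mul_cancel hy.1, hq]

lemma quarticPairs_prime_pow_le_add {p : ℕ} (hp : p.Prime) {k : ℕ} (hk : 1 ≤ k) :
    quarticPairs (p ^ k) ≤
      16 * p ^ k + p ^ (2 * min 3 (k - 1)) * quarticPairs (p ^ (k - 4)) := by
  classical
  have : NeZero (p ^ k) := ⟨pow_ne_zero _ hp.ne_zero⟩
  have : NeZero (p ^ (k - 4)) := ⟨pow_ne_zero _ hp.ne_zero⟩
  unfold quarticPairs
  rw [Nat.card_eq_fintype_card, Fintype.card_subtype, Nat.card_eq_fintype_card,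
    Fintype.card_subtype]
  set S := Finset.univ.filter fun z : ZMod (p ^ k) × ZMod (p ^ k) => z.1 ^ 4 = z.2 ^ 4 with hS
  rw [← Finset.card_filter_add_card_filter_not (s := S) (fun z => IsUnit z.1)]
  apply add_le_add
  · have := Finset.card_le_mul_card_image_of_maps_to
      (s := S.filter fun z => IsUnit z.1) (t := (Finset.univ : Finset (ZMod (p ^ k))))
      (f := Prod.fst) (fun _ _ => Finset.mem_univ _) 16
      (by
        intro b _
        by_cases hb : IsUnit b
        · obtain ⟨u, rfl⟩ := hb
          refine le_trans (Finset.card_le_card (t := (Finset.univ.filter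
            fun y : (ZMod (p ^ k))ˣ => y ^ 4 = u ^ 4).image
              (fun y : (ZMod (p ^ k))ˣ => ((u : ZMod (p ^ k)), (y : ZMod (p ^ k))))) ?_)
            (Finset.card_image_le.trans (card_units_pow_four_eq_le hp k _))
          rintro ⟨x, y⟩ hz
          simp only [hS, Finset.mem_filter, Finset.mem_univ, true_and] at hz
          obtain ⟨⟨h4, _⟩, rfl⟩ := hz
          have hy : IsUnit y := by
            rw [← isUnit_pow_iff (n := 4) (by norm_num), ← h4]
            exact u.isUnit.pow 4
          obtain ⟨v, rfl⟩ := hy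
          simp only [Finset.mem_image, Finset.mem_filter, Finset.mem_univ, true_and]
          refine ⟨v, Units.ext ?_, rfl⟩
          push_cast
          exact h4.symm
        · rw [Finset.card_eq_zero.2]
          · norm_num
          · refine Finset.filter_eq_empty_iff.2 ?_
            intro z hz hzb
            rw [Finset.mem_filter] at hz
            exact hb (hzb ▸ hz.2))
    simpa [ZMod.card] using this
  · have hdvd : ∀ z ∈ S.filter fun z => ¬ IsUnit z.1, p ∣ z.1.val ∧ p ∣ z.2.val := by
      rintro ⟨x, y⟩ hz
      simp only [hS, Finset.mem_filter, Finset.mem_univ, true_and] at hz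
      obtain ⟨h4, hx⟩ := hz
      have key : ∀ w : ZMod (p ^ k), ¬ IsUnit w → p ∣ w.val := by
        intro w hw
        by_contra hc
        apply hw
        rw [← ZMod.natCast_zmod_val w, ZMod.isUnit_iff_coprime]
        exact ((hp.coprime_iff_not_dvd.2 hc).symm).pow_right k
      refine ⟨key x hx, key y fun hy => hx ?_⟩
      rw [← isUnit_pow_iff (n := 4) (by norm_num), h4]
      exact hy.pow 4
    have := Finset.card_le_mul_card_image_of_maps_to
      (s := S.filter fun z => ¬ IsUnit z.1)
      (t := Finset.univ.filter
        fun z : ZMod (p ^ (k - 4)) × ZMod (p ^ (k - 4)) => z.1 ^ 4 = z.2 ^ 4)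
      (f := fun z => (((z.1.val / p : ℕ) : ZMod (p ^ (k - 4))), ((z.2.val / p : ℕ) : ZMod (p ^ (k - 4)))))
      (by
        rintro ⟨x, y⟩ hz
        obtain ⟨⟨X, hX⟩, ⟨Y, hY⟩⟩ := hdvd _ hz
        simp only [hS, Finset.mem_filter, Finset.mem_univ, true_and] at hz hX hY ⊢
        rw [hX, hY, Nat.mul_div_cancel_left _ hp.pos, Nat.mul_div_cancel_left _ hp.pos]
        rcases le_or_gt k 4 with h4 | h4
        · have : Subsingleton (ZMod (p ^ (k - 4))) := by
            rw [Nat.sub_eq_zero_of_le h4, pow_zero]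
            exact inferInstanceAs (Subsingleton (Fin 1))
          exact Subsingleton.elim _ _
        have h1 := hz.1
        rw [← ZMod.natCast_zmod_val x, ← ZMod.natCast_zmod_val y, hX, hY] at h1
        have h2 : (((p * X : ℕ) : ℤ) ^ 4 - ((p * Y : ℕ) : ℤ) ^ 4 : ℤ) = p ^ 4 * (X ^ 4 - Y ^ 4) := by
          push_cast; ring
        have h3 : ((p ^ k : ℕ) : ℤ) ∣ (p : ℤ) ^ 4 * (X ^ 4 - Y ^ 4) := by
          rw [← h2, ← ZMod.intCast_zmod_eq_zero_iff_dvd]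
          push_cast
          push_cast at h1
          rw [h1, sub_self]
        rw [show p ^ k = p ^ 4 * p ^ (k - 4) by rw [← pow_add]; congr 1; omega] at h3
        rw [Nat.cast_mul, Nat.cast_pow p 4] at h3
        have h5 := Int.dvd_of_mul_dvd_mul_left (pow_ne_zero 4 (by exact_mod_cast hp.ne_zero)) h3
        rw [← ZMod.intCast_zmod_eq_zero_iff_dvd] at h5
        push_cast at h5
        exact sub_eq_zero.1 h5) (p ^ (2 * min 3 (k - 1)))
      (by
        rintro ⟨a, b⟩ _
        rw [two_mul, pow_add]
        refine le_trans (Finset.card_le_card ?_) ((Finset.card_product _ _).le.trans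
          (Nat.mul_le_mul (card_multiples_in_class_le hk a)
            (card_multiples_in_class_le hk b)))
        rintro ⟨x, y⟩ hz
        rw [Finset.mem_filter] at hz
        obtain ⟨h1, h2⟩ := hdvd _ hz.1
        have h3 := Prod.mk.inj hz.2
        simp only [Finset.mem_product, Finset.mem_filter, Finset.mem_univ, true_and]
        exact ⟨⟨h1, h3.1⟩, ⟨h2, h3.2⟩⟩)
    exact this

lemma quarticPairs_prime_pow_le {p : ℕ} (hp : p.Prime) {r : ℝ} (hr : 1 ≤ r) (hrp : r ^ 2 = p)
    (k : ℕ) : (quarticPairs (p ^ k) : ℝ) ≤ 17 * (k + 1) * r ^ (3 * k) := by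
  have hr0 : 0 ≤ r := zero_le_one.trans hr
  induction k using Nat.strong_induction_on with
  | _ k ih =>
    rcases Nat.eq_zero_or_pos k with rfl | hk
    · simp [quarticPairs_one]
    have hrec : (quarticPairs (p ^ k) : ℝ) ≤
        16 * r ^ (2 * k) + r ^ (2 * (2 * min 3 (k - 1))) * quarticPairs (p ^ (k - 4)) := by
      rw [pow_mul r 2 k, pow_mul r 2 (2 * _), hrp]
      exact_mod_cast quarticPairs_prime_pow_le_add hp hk
    have h1 : r ^ (2 * k) ≤ r ^ (3 * k) := pow_le_pow_right₀ hr (by omega)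
    have hpos : 0 ≤ r ^ (3 * k) := by positivity
    rcases le_or_gt k 3 with h3 | h3
    · rw [Nat.sub_eq_zero_of_le (by omega : k ≤ 4), pow_zero, quarticPairs_one, Nat.cast_one,
        mul_one] at hrec
      have h2 : r ^ (2 * (2 * min 3 (k - 1))) ≤ r ^ (3 * k) := pow_le_pow_right₀ hr (by omega)
      have : (0 : ℝ) ≤ k * r ^ (3 * k) := by positivity
      nlinarith
    · have h2 := ih (k - 4) (by omega)
      have h4 : r ^ (2 * (2 * min 3 (k - 1))) * quarticPairs (p ^ (k - 4)) ≤
          17 * ((k - 4 : ℕ) + 1) * r ^ (3 * k) := by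
        calc _ ≤ r ^ (2 * (2 * min 3 (k - 1))) * (17 * ((k - 4 : ℕ) + 1) * r ^ (3 * (k - 4))) := by
              gcongr
          _ = 17 * ((k - 4 : ℕ) + 1) * (r ^ (2 * (2 * min 3 (k - 1))) * r ^ (3 * (k - 4))) := by
              ring
          _ = _ := by
              rw [← pow_add]
              congr 2
              omega
      rw [Nat.cast_sub (by omega)] at h4
      push_cast at h4
      nlinarith

lemma quarticWeight_prime_pow_le {p : ℕ} (hp : p.Prime) {k : ℕ} (hk : 1 ≤ k) :
    quarticWeight (p ^ k) ≤ 544 * (k + 1) * (√(p : ℝ) ^ (max k 2))⁻¹ := by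
  set r := √(p : ℝ) with hrdef
  have hrp : r ^ 2 = p := Real.sq_sqrt (Nat.cast_nonneg p)
  have hp1 : (1 : ℝ) ≤ p := by exact_mod_cast hp.one_lt.le
  have hr : 1 ≤ r := Real.one_le_sqrt.2 hp1
  have hr0 : 0 < r := zero_lt_one.trans_le hr
  have hM : (quarticPairs (p ^ k) : ℝ) ≤ 17 * (k + 1) * (r ^ (4 * k) * (r ^ (max k 2))⁻¹) := by
    rcases le_or_gt 2 k with h2 | h2
    · rw [max_eq_left h2]
      have : r ^ (4 * k) * (r ^ k)⁻¹ = r ^ (3 * k) := by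
        rw [show 4 * k = 3 * k + k by ring, pow_add]
        field_simp
      rw [this]
      exact quarticPairs_prime_pow_le hp hr hrp k
    · obtain rfl : k = 1 := by omega
      have h := quarticPairs_prime_pow_le_add hp le_rfl
      have h' : (quarticPairs (p ^ 1) : ℝ) ≤ 16 * r ^ 2 + 1 := by
        rw [hrp]
        have : quarticPairs (p ^ 1) ≤ 16 * p + 1 := by simpa [quarticPairs_one] using h
        exact_mod_cast this
      have h3 : r ^ (4 * 1) * (r ^ (max 1 2))⁻¹ = r ^ 2 := by
        rw [max_eq_right (by norm_num)]
        field_simp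
      rw [h3]
      push_cast
      nlinarith
  have hN : (quarticRoots (p ^ k) : ℝ) ≤ 16 := by exact_mod_cast quarticRoots_prime_pow_le hp k
  have hφ : r ^ (2 * k) / 2 ≤ ((p ^ k).totient : ℝ) := by
    have h1 : p ^ k ≤ 2 * (p ^ k).totient := by
      rw [Nat.totient_prime_pow hp hk]
      obtain ⟨j, rfl⟩ : ∃ j, k = j + 1 := ⟨k - 1, by omega⟩
      rw [Nat.add_sub_cancel, pow_succ, ← mul_assoc, mul_comm 2, mul_assoc]
      exact Nat.mul_le_mul_left _ (by have := hp.two_le; omega)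
    rw [pow_mul, hrp]
    have : ((p ^ k : ℕ) : ℝ) ≤ 2 * ((p ^ k).totient : ℝ) := by exact_mod_cast h1
    push_cast at this
    linarith
  have hq : ((p ^ k : ℕ) : ℝ) = r ^ (2 * k) := by rw [pow_mul, hrp]; push_cast; rfl
  unfold quarticWeight
  rw [hq]
  have hpos : 0 < r ^ (2 * k) := by positivity
  calc _ ≤ 17 * (k + 1) * (r ^ (4 * k) * (r ^ (max k 2))⁻¹) * 16
        / (r ^ (2 * k) * (r ^ (2 * k) / 2)) := by gcongr
    _ = _ := by
        rw [show 4 * k = 2 * k + 2 * k by ring, pow_add]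
        field_simp
        ring

/-- A majorant for the normalised number of solutions of `x⁴ + y⁴ = z⁴ + w⁴` modulo `q`. -/
def quarticEnergyBound (q : ℕ) : ℝ := ∑ d ∈ q.divisors, (d : ℝ) * quarticWeight d ^ 2

lemma quarticEnergyBound_nonneg (q : ℕ) : 0 ≤ quarticEnergyBound q :=
  Finset.sum_nonneg fun _ _ => by positivity

lemma quarticEnergyBound_mul {m n : ℕ} (hmn : m.Coprime n) :
    quarticEnergyBound (m * n) = quarticEnergyBound m * quarticEnergyBound n := by
  let F : ArithmeticFunction ℝ := ⟨fun n => (n : ℝ) * quarticWeight n ^ 2, by simp⟩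
  have hF : F.IsMultiplicative := by
    refine ⟨?_, fun {a b} hab => ?_⟩
    · simp [F, quarticWeight_one]
    · simp only [F, ArithmeticFunction.coe_mk, quarticWeight_mul hab]
      push_cast
      ring
  have hE : ∀ k, quarticEnergyBound k = (F * (ArithmeticFunction.zeta : ArithmeticFunction ℝ)) k := by
    intro k
    rw [ArithmeticFunction.coe_mul_zeta_apply]
    rfl
  rw [hE, hE, hE]
  exact (hF.mul ArithmeticFunction.isMultiplicative_zeta.natCast).2 hmn

lemma quarticEnergyBound_prime_pow_le {p : ℕ} (hp : p.Prime) (k : ℕ) :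
    quarticEnergyBound (p ^ k) ≤ 544 ^ 2 * ((k : ℝ) + 1) ^ 3 := by
  unfold quarticEnergyBound
  rw [Nat.sum_divisors_prime_pow hp]
  have hterm : ∀ j ∈ Finset.range (k + 1),
      ((p ^ j : ℕ) : ℝ) * quarticWeight (p ^ j) ^ 2 ≤ 544 ^ 2 * ((k : ℝ) + 1) ^ 2 := by
    intro j hj
    have hjk : (j : ℝ) ≤ k := by exact_mod_cast Nat.lt_succ_iff.1 (Finset.mem_range.1 hj)
    rcases Nat.eq_zero_or_pos j with rfl | hj0
    · simp only [pow_zero, Nat.cast_one, quarticWeight_one, one_pow, mul_one]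
      nlinarith [(Nat.cast_nonneg k : (0 : ℝ) ≤ k)]
    set r := √(p : ℝ)
    have hrp : r ^ 2 = p := Real.sq_sqrt (Nat.cast_nonneg p)
    have hr : 1 ≤ r := Real.one_le_sqrt.2 (by exact_mod_cast hp.one_lt.le)
    have hr0 : 0 < r := zero_lt_one.trans_le hr
    have hw : quarticWeight (p ^ j) ≤ 544 * (k + 1) * (r ^ j)⁻¹ := by
      refine (quarticWeight_prime_pow_le hp hj0).trans ?_
      gcongr
      · exact le_max_left _ _
    calc _ ≤ ((p ^ j : ℕ) : ℝ) * (544 * (k + 1) * (r ^ j)⁻¹) ^ 2 := by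
          gcongr
          exact quarticWeight_nonneg _
      _ = _ := by
          rw [Nat.cast_pow, ← hrp]
          field_simp
          ring
  refine (Finset.sum_le_card_nsmul _ _ _ hterm).trans (le_of_eq ?_)
  rw [Finset.card_range, nsmul_eq_mul]
  push_cast
  ring

lemma quarticWeight_rpow_mul_energy_prime_pow_le {p : ℕ} (hp : p.Prime) {k : ℕ} (hk : 1 ≤ k) :
    quarticWeight (p ^ k) ^ ((9 : ℝ) / 8) * quarticEnergyBound (p ^ k) ≤
      544 ^ 4 * (2 * ((k : ℝ) + 1) ^ 5 * (√2)⁻¹ ^ k) * (p : ℝ) ^ (-(9 : ℝ) / 8) := by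
  have hp2 : (2 : ℝ) ≤ p := by exact_mod_cast hp.two_le
  have hrp : √(p : ℝ) ^ 2 = p := Real.sq_sqrt (Nat.cast_nonneg p)
  have hs1 : 1 ≤ √2 := Real.one_le_sqrt.2 (by norm_num)
  have hs0 : 0 < √2 := zero_lt_one.trans_le hs1
  have hs2 : √2 ^ 2 = 2 := Real.sq_sqrt (by norm_num)
  have hs : √2 ≤ √(p : ℝ) := Real.sqrt_le_sqrt hp2
  have hk1 : (1 : ℝ) ≤ k + 1 := by linarith [(Nat.cast_nonneg k : (0 : ℝ) ≤ k)]
  have hlow : (p : ℝ) * √2 ^ (k - 2) ≤ √(p : ℝ) ^ (max k 2) := by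
    rw [show max k 2 = 2 + (k - 2) by omega, pow_add, hrp]
    gcongr
  have hw : quarticWeight (p ^ k) ≤ 544 * (k + 1) * ((p : ℝ) * √2 ^ (k - 2))⁻¹ := by
    refine (quarticWeight_prime_pow_le hp hk).trans ?_
    gcongr
  have hA : (544 * ((k : ℝ) + 1)) ^ ((9 : ℝ) / 8) ≤ (544 * ((k : ℝ) + 1)) ^ 2 := by
    rw [← Real.rpow_natCast _ 2]
    exact Real.rpow_le_rpow_of_exponent_le (by nlinarith) (by norm_num)
  have hB : (√2 ^ (k - 2)) ^ (-(9 : ℝ) / 8) ≤ 2 * (√2)⁻¹ ^ k := by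
    calc _ ≤ (√2 ^ (k - 2)) ^ (-1 : ℝ) :=
          Real.rpow_le_rpow_of_exponent_le (one_le_pow₀ hs1) (by norm_num)
      _ = (√2 ^ (k - 2))⁻¹ := Real.rpow_neg_one _
      _ ≤ 2 * (√2)⁻¹ ^ k := by
          rw [inv_pow, ← div_eq_mul_inv, le_div_iff₀ (by positivity), inv_mul_le_iff₀ (by positivity),
            ← mul_comm 2]
          nth_rewrite 2 [← hs2]
          rw [← pow_add]
          exact pow_le_pow_right₀ hs1 (by omega)
  have hC : (((p : ℝ) * √2 ^ (k - 2))⁻¹) ^ ((9 : ℝ) / 8) =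
      (p : ℝ) ^ (-(9 : ℝ) / 8) * (√2 ^ (k - 2)) ^ (-(9 : ℝ) / 8) := by
    rw [Real.inv_rpow (by positivity), ← Real.rpow_neg (by positivity),
      Real.mul_rpow (by positivity) (by positivity)]
    norm_num
  calc _ ≤ (544 * (k + 1) * ((p : ℝ) * √2 ^ (k - 2))⁻¹) ^ ((9 : ℝ) / 8) *
        (544 ^ 2 * ((k : ℝ) + 1) ^ 3) := by
        gcongr
        · exact quarticEnergyBound_nonneg _
        · exact quarticWeight_nonneg _
        · exact quarticEnergyBound_prime_pow_le hp k
    _ = (544 * (k + 1)) ^ ((9 : ℝ) / 8) *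
        ((p : ℝ) ^ (-(9 : ℝ) / 8) * (√2 ^ (k - 2)) ^ (-(9 : ℝ) / 8)) *
        (544 ^ 2 * ((k : ℝ) + 1) ^ 3) := by
        rw [Real.mul_rpow (by positivity) (by positivity), hC]
    _ ≤ (544 * (k + 1)) ^ 2 * ((p : ℝ) ^ (-(9 : ℝ) / 8) * (2 * (√2)⁻¹ ^ k)) *
        (544 ^ 2 * ((k : ℝ) + 1) ^ 3) := by gcongr
    _ = _ := by ring

lemma exists_sum_quarticWeight_le :
    ∃ C : ℝ, 0 ≤ C ∧ ∀ Q : ℕ, ∑ q ∈ Finset.Icc 1 Q,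
      quarticWeight q ^ ((9 : ℝ) / 8) * quarticEnergyBound q ≤ C := by
  set G : ℕ → ℝ := fun q => quarticWeight q ^ ((9 : ℝ) / 8) * quarticEnergyBound q with hG
  have hG0 : ∀ q, 0 ≤ G q := fun q =>
    mul_nonneg (Real.rpow_nonneg (quarticWeight_nonneg q) _) (quarticEnergyBound_nonneg q)
  have hG1 : G 1 = 1 := by simp [hG, quarticWeight_one, quarticEnergyBound]
  have hGmul : ∀ {m n : ℕ}, m.Coprime n → G (m * n) = G m * G n := by
    intro m n hmn
    simp only [hG, quarticWeight_mul hmn, quarticEnergyBound_mul hmn,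
      Real.mul_rpow (quarticWeight_nonneg m) (quarticWeight_nonneg n)]
    ring
  set a : ℕ → ℝ := fun k => 2 * ((k : ℝ) + 1) ^ 5 * (√2)⁻¹ ^ k with ha
  have hs1 : 1 < √2 := by
    rw [Real.lt_sqrt (by norm_num)]; norm_num
  have ha0 : ∀ k, 0 ≤ a k := fun k => by positivity
  have hasum : Summable a := by
    have h1 : Summable fun k : ℕ => (k : ℝ) ^ 5 * (√2)⁻¹ ^ k := by
      apply summable_pow_mul_geometric_of_norm_lt_one
      rw [Real.norm_of_nonneg (by positivity)]
      exact inv_lt_one_of_one_lt₀ hs1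
    have h2 := ((summable_nat_add_iff 1).2 h1).mul_left (2 * √2)
    refine h2.congr fun k => ?_
    simp only [ha]
    push_cast
    rw [pow_succ (√2)⁻¹]
    field_simp
  have hbound : ∀ {p : ℕ}, p.Prime → ∀ k, 1 ≤ k →
      G (p ^ k) ≤ 544 ^ 4 * a k * (p : ℝ) ^ (-(9 : ℝ) / 8) := fun hp k hk =>
    quarticWeight_rpow_mul_energy_prime_pow_le hp hk
  have hsummable' : ∀ {p : ℕ}, p.Prime → Summable fun n => G (p ^ (n + 1)) := by
    intro p hp
    refine Summable.of_nonneg_of_le (fun n => hG0 _) (fun n => hbound hp (n + 1) (by omega)) ?_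
    exact (((summable_nat_add_iff 1).2 hasum).mul_left _).mul_right _
  have hsummable : ∀ {p : ℕ}, p.Prime → Summable fun n => G (p ^ n) := fun hp =>
    (summable_nat_add_iff 1).1 (hsummable' hp)
  set B : ℝ := ∑' k, a (k + 1) with hB
  have hB0 : 0 ≤ B := tsum_nonneg fun k => ha0 _
  have hlocal : ∀ {p : ℕ}, p.Prime →
      ∑' n, G (p ^ n) ≤ Real.exp (544 ^ 4 * B * (p : ℝ) ^ (-(9 : ℝ) / 8)) := by
    intro p hp
    rw [(hsummable hp).tsum_eq_zero_add, pow_zero, hG1]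
    have : ∑' n, G (p ^ (n + 1)) ≤ 544 ^ 4 * B * (p : ℝ) ^ (-(9 : ℝ) / 8) := by
      rw [hB, ← tsum_mul_left, ← tsum_mul_right]
      exact (hsummable' hp).tsum_le_tsum (fun n => hbound hp (n + 1) (by omega))
        ((((summable_nat_add_iff 1).2 hasum).mul_left _).mul_right _)
    linarith [Real.add_one_le_exp (544 ^ 4 * B * (p : ℝ) ^ (-(9 : ℝ) / 8))]
  have hzeta : Summable fun n : ℕ => (n : ℝ) ^ (-(9 : ℝ) / 8) :=
    Real.summable_nat_rpow.2 (by norm_num)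
  refine ⟨Real.exp (544 ^ 4 * B * ∑' n : ℕ, (n : ℝ) ^ (-(9 : ℝ) / 8)), by positivity,
    fun Q => ?_⟩
  have hEP := (EulerProduct.summable_and_hasSum_smoothNumbers_prod_primesBelow_tsum hG1 hGmul
    (fun hp => by simpa only [Real.norm_of_nonneg (hG0 _)] using hsummable hp) (Q + 1)).2
  have hEP' : HasSum ((Nat.smoothNumbers (Q + 1)).indicator G)
      (∏ p ∈ (Q + 1).primesBelow, ∑' n, G (p ^ n)) := hasSum_subtype_iff_indicator.1 hEP
  calc ∑ q ∈ Finset.Icc 1 Q, G q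
      = ∑ q ∈ Finset.Icc 1 Q, (Nat.smoothNumbers (Q + 1)).indicator G q := by
        refine Finset.sum_congr rfl fun q hq => ?_
        rw [Finset.mem_Icc] at hq
        rw [Set.indicator_of_mem (Nat.mem_smoothNumbers_of_lt hq.1 (by omega))]
    _ ≤ ∏ p ∈ (Q + 1).primesBelow, ∑' n, G (p ^ n) :=
        sum_le_hasSum _ (fun q _ => Set.indicator_nonneg (fun q _ => hG0 q) q) hEP'
    _ ≤ ∏ p ∈ (Q + 1).primesBelow, Real.exp (544 ^ 4 * B * (p : ℝ) ^ (-(9 : ℝ) / 8)) :=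
        Finset.prod_le_prod (fun p _ => tsum_nonneg fun n => hG0 _)
          (fun p hp => hlocal (Nat.prime_of_mem_primesBelow hp))
    _ = Real.exp (544 ^ 4 * B * ∑ p ∈ (Q + 1).primesBelow, (p : ℝ) ^ (-(9 : ℝ) / 8)) := by
        rw [← Real.exp_sum, Finset.mul_sum]
    _ ≤ _ := by
        gcongr
        exact hzeta.sum_le_tsum _ (fun n _ => by positivity)

lemma norm_e (z : ℝ) : ‖e z‖ = 1 := by
  unfold e
  rw [show 2 * (Real.pi : ℂ) * Complex.I * z = ((2 * Real.pi * z : ℝ) : ℂ) * Complex.I by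
    push_cast; ring]
  exact Complex.norm_exp_ofReal_mul_I _

lemma e_add (x y : ℝ) : e (x + y) = e x * e y := by
  unfold e
  rw [← Complex.exp_add]
  congr 1
  push_cast
  ring

lemma e_div_eq_stdAddChar (q : ℕ) [NeZero q] (j : ℤ) :
    e ((j : ℝ) / q) = ZMod.stdAddChar (j : ZMod q) := by
  rw [ZMod.stdAddChar_coe]
  unfold e
  congr 1
  push_cast
  ring

/-- Orthogonality of additive characters, as a mean square bound. -/
lemma sum_norm_sq_eq {ι : Type*} [DecidableEq ι] (q : ℕ) [NeZero q] (s : Finset ι)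
    (φ : ι → ZMod q) (c : ι → ℂ) :
    ((∑ u : ZMod q, ‖∑ i ∈ s, c i * ZMod.stdAddChar (u * φ i)‖ ^ 2 : ℝ) : ℂ) =
      q * ∑ z ∈ (s ×ˢ s).filter (fun z => φ z.1 = φ z.2), c z.1 * (starRingEnd ℂ) (c z.2) := by
  have h1 : ∀ u : ZMod q, ((‖∑ i ∈ s, c i * ZMod.stdAddChar (u * φ i)‖ ^ 2 : ℝ) : ℂ) =
      ∑ z ∈ s ×ˢ s, c z.1 * (starRingEnd ℂ) (c z.2) *
        ZMod.stdAddChar (u * (φ z.1 - φ z.2)) := by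
    intro u
    rw [Complex.ofReal_pow, ← Complex.mul_conj', map_sum, Finset.sum_mul_sum,
      Finset.sum_product]
    refine Finset.sum_congr rfl fun i _ => Finset.sum_congr rfl fun j _ => ?_
    rw [map_mul (starRingEnd ℂ), ← AddChar.map_neg_eq_conj, mul_sub, sub_eq_add_neg, AddChar.map_add_eq_mul]
    ring
  rw [Complex.ofReal_sum, Finset.sum_congr rfl fun u _ => h1 u, Finset.sum_comm, Finset.sum_filter,
    Finset.mul_sum]
  refine Finset.sum_congr rfl fun z _ => ?_
  rw [← Finset.mul_sum, AddChar.sum_mulShift _ (ZMod.isPrimitive_stdAddChar q), ZMod.card]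
  by_cases h : φ z.1 = φ z.2
  · simp [h, mul_comm]
  · simp [h, sub_eq_zero]

lemma sum_norm_sq_le {ι : Type*} [DecidableEq ι] (q : ℕ) [NeZero q] (s : Finset ι)
    (φ : ι → ZMod q) (c : ι → ℂ) (hc : ∀ i, ‖c i‖ ≤ 1) :
    ∑ u : ZMod q, ‖∑ i ∈ s, c i * ZMod.stdAddChar (u * φ i)‖ ^ 2 ≤
      q * (((s ×ˢ s).filter fun z => φ z.1 = φ z.2).card : ℝ) := by
  have h := congrArg norm (sum_norm_sq_eq q s φ c)
  rw [Complex.norm_real, Real.norm_of_nonneg (by positivity), norm_mul, Complex.norm_natCast] at h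
  rw [h]
  gcongr
  refine (norm_sum_le _ _).trans ?_
  rw [← nsmul_one]
  refine Finset.sum_le_card_nsmul _ _ _ fun z _ => ?_
  rw [norm_mul, RCLike.norm_conj]
  exact mul_le_one₀ (hc _) (norm_nonneg _) (hc _)

lemma sum_norm_sq_eq_card {ι : Type*} [DecidableEq ι] (q : ℕ) [NeZero q] (s : Finset ι)
    (φ : ι → ZMod q) :
    ∑ u : ZMod q, ‖∑ i ∈ s, (ZMod.stdAddChar (u * φ i) : ℂ)‖ ^ 2 =
      q * (((s ×ˢ s).filter fun z => φ z.1 = φ z.2).card : ℝ) := by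
  have h := sum_norm_sq_eq q s φ (fun _ => 1)
  simp only [one_mul, map_one, Finset.sum_const, nsmul_one] at h
  exact_mod_cast h

/-- The complete quartic exponential sum with modulus `q`. -/
def quarticSum (q : ℕ) (a : ℤ) : ℂ := ∑ x ∈ Finset.range q, e ((a : ℝ) * (x : ℝ) ^ 4 / q)

lemma e_quartic_eq_stdAddChar (q : ℕ) [NeZero q] (a : ℤ) (x : ℕ) :
    e ((a : ℝ) * (x : ℝ) ^ 4 / q) = ZMod.stdAddChar ((a : ZMod q) * (x : ZMod q) ^ 4) := by
  rw [show (a : ℝ) * (x : ℝ) ^ 4 = ((a * (x : ℤ) ^ 4 : ℤ) : ℝ) by push_cast; rfl,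
    e_div_eq_stdAddChar]
  push_cast
  rfl

lemma sum_range_eq_sum_zmod {M : Type*} [AddCommMonoid M] (q : ℕ) [NeZero q] (F : ZMod q → M) :
    ∑ x ∈ Finset.range q, F x = ∑ x : ZMod q, F x := by
  refine Finset.sum_bij (fun x _ => (x : ZMod q)) (fun _ _ => Finset.mem_univ _) ?_ ?_ ?_
  · intro x hx y hy hxy
    rw [Finset.mem_range] at hx hy
    rw [ZMod.natCast_eq_natCast_iff', Nat.mod_eq_of_lt hx, Nat.mod_eq_of_lt hy] at hxy
    exact hxy
  · intro z _
    exact ⟨z.val, Finset.mem_range.2 (ZMod.val_lt z), ZMod.natCast_zmod_val z⟩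
  · intro _ _
    rfl

lemma quarticSum_eq (q : ℕ) [NeZero q] (a : ℤ) :
    quarticSum q a = ∑ x : ZMod q, ZMod.stdAddChar ((a : ZMod q) * x ^ 4) := by
  rw [← sum_range_eq_sum_zmod q fun x => (ZMod.stdAddChar ((a : ZMod q) * x ^ 4) : ℂ)]
  exact Finset.sum_congr rfl fun x _ => e_quartic_eq_stdAddChar q a x

lemma sum_norm_sq_stdAddChar_quartic (q : ℕ) [NeZero q] :
    ∑ u : ZMod q, ‖∑ x : ZMod q, (ZMod.stdAddChar (u * x ^ 4) : ℂ)‖ ^ 2 = q * quarticPairs q := by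
  rw [sum_norm_sq_eq_card q Finset.univ fun x => x ^ 4]
  unfold quarticPairs
  rw [Nat.card_eq_fintype_card, Fintype.card_subtype, Finset.univ_product_univ]

lemma card_units_pow_four_eq_le_quarticRoots (q : ℕ) [NeZero q] (c : (ZMod q)ˣ) :
    (Finset.univ.filter fun y : (ZMod q)ˣ => y ^ 4 = c).card ≤ quarticRoots q := by
  rcases (Finset.univ.filter fun y : (ZMod q)ˣ => y ^ 4 = c).eq_empty_or_nonempty with h | ⟨y₀, hy₀⟩
  · rw [h]; simp
  simp only [Finset.mem_filter, Finset.mem_univ, true_and] at hy₀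
  unfold quarticRoots
  rw [Nat.card_eq_fintype_card, Fintype.card_subtype]
  refine Finset.card_le_card_of_injOn (fun y => y * y₀⁻¹) ?_ (fun a _ b _ hab => by simpa using hab)
  intro y hy
  simp only [Finset.coe_filter, Finset.mem_univ, true_and, Set.mem_ofPred_eq] at hy ⊢
  rw [mul_pow, hy, inv_pow, hy₀, mul_inv_cancel]

lemma card_units_mul_pow_four_eq_le (q : ℕ) [NeZero q] (b : ℤ) (hb : b ≠ 0) (α : (ZMod q)ˣ)
    (v : ZMod q) :
    (Finset.univ.filter fun y : (ZMod q)ˣ =>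
      (b : ZMod q) * (α : ZMod q) * (y : ZMod q) ^ 4 = v).card ≤ quarticRoots q * b.natAbs := by
  rcases (Finset.univ.filter fun y : (ZMod q)ˣ =>
      (b : ZMod q) * (α : ZMod q) * (y : ZMod q) ^ 4 = v).eq_empty_or_nonempty with h | ⟨y₀, hy₀⟩
  · rw [h]; simp
  simp only [Finset.mem_filter, Finset.mem_univ, true_and] at hy₀
  refine (Finset.card_le_mul_card_image_of_maps_to
    (t := Finset.univ.filter fun z : ZMod q => (b : ZMod q) * z = 0)
    (f := fun y : (ZMod q)ˣ => (α : ZMod q) * ((y : ZMod q) ^ 4 - (y₀ : ZMod q) ^ 4)) ?_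
    (quarticRoots q) ?_).trans (Nat.mul_le_mul_left _ (card_zmod_mul_eq_zero_le q b hb))
  · intro y hy
    simp only [Finset.mem_filter, Finset.mem_univ, true_and] at hy ⊢
    linear_combination hy - hy₀
  · intro w _
    by_cases hw : ∃ y₁ : (ZMod q)ˣ, (α : ZMod q) * ((y₁ : ZMod q) ^ 4 - (y₀ : ZMod q) ^ 4) = w
    · obtain ⟨y₁, hy₁⟩ := hw
      refine le_trans (Finset.card_le_card ?_) (card_units_pow_four_eq_le_quarticRoots q (y₁ ^ 4))
      intro y hy
      simp only [Finset.mem_filter, Finset.mem_univ, true_and] at hy ⊢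
      have h1 := α.isUnit.mul_left_cancel (hy.2.trans hy₁.symm)
      apply Units.ext
      push_cast
      linear_combination h1
    · rw [Finset.card_eq_zero.2]
      · exact Nat.zero_le _
      · exact Finset.filter_eq_empty_iff.2 fun y _ hy => hw ⟨y, hy⟩

lemma norm_quarticSum_sq_le (q : ℕ) [NeZero q] (b : ℤ) (hb : b ≠ 0) (a : ℤ)
    (ha : IsUnit (a : ZMod q)) :
    ‖quarticSum q (b * a)‖ ^ 2 ≤ |(b : ℝ)| * (q : ℝ) ^ 2 * quarticWeight q := by
  obtain ⟨α, hα⟩ := ha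
  set T : ZMod q → ℂ := fun u => ∑ x : ZMod q, (ZMod.stdAddChar (u * x ^ 4) : ℂ) with hT
  have hTb : ∀ (u : ZMod q) (y : (ZMod q)ˣ), T (u * (y : ZMod q) ^ 4) = T u := by
    intro u y
    simp only [hT]
    refine Fintype.sum_equiv y.mulLeft _ _ fun x => ?_
    simp only [Units.mulLeft_apply]
    congr 1
    ring
  have hq : quarticSum q (b * a) = T ((b : ZMod q) * α) := by
    rw [quarticSum_eq, hα]
    push_cast
    rfl
  have h1 : (q.totient : ℝ) * ‖T ((b : ZMod q) * α)‖ ^ 2 ≤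
      (quarticRoots q * b.natAbs : ℕ) * (q * quarticPairs q : ℝ) := by
    calc _ = ∑ y : (ZMod q)ˣ, ‖T ((b : ZMod q) * α * (y : ZMod q) ^ 4)‖ ^ 2 := by
          simp only [hTb, Finset.sum_const, Finset.card_univ, ZMod.card_units_eq_totient,
            nsmul_eq_mul]
      _ = ∑ v : ZMod q, ∑ y ∈ Finset.univ.filter (fun y : (ZMod q)ˣ =>
            (b : ZMod q) * (α : ZMod q) * (y : ZMod q) ^ 4 = v),
            ‖T ((b : ZMod q) * α * (y : ZMod q) ^ 4)‖ ^ 2 :=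
          (Finset.sum_fiberwise_of_maps_to (fun _ _ => Finset.mem_univ _) _).symm
      _ ≤ ∑ v : ZMod q, (quarticRoots q * b.natAbs : ℕ) * ‖T v‖ ^ 2 := by
          refine Finset.sum_le_sum fun v _ => ?_
          rw [Finset.sum_congr rfl (g := fun _ => ‖T v‖ ^ 2) (by
            intro y hy
            rw [(Finset.mem_filter.1 hy).2]), Finset.sum_const, nsmul_eq_mul]
          gcongr
          exact card_units_mul_pow_four_eq_le q b hb α v
      _ = _ := by
          rw [← Finset.mul_sum, sum_norm_sq_stdAddChar_quartic]
  have hφ : (0 : ℝ) < q.totient := by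
    exact_mod_cast Nat.totient_pos.2 (Nat.pos_of_ne_zero (NeZero.ne q))
  have hq0 : (0 : ℝ) < q := by exact_mod_cast Nat.pos_of_ne_zero (NeZero.ne q)
  rw [hq]
  have h2 : ‖T ((b : ZMod q) * α)‖ ^ 2 ≤
      (quarticRoots q * b.natAbs : ℕ) * (q * quarticPairs q : ℝ) / q.totient := by
    rw [le_div_iff₀ hφ, mul_comm]
    exact h1
  refine h2.trans (le_of_eq ?_)
  have hab : ((b.natAbs : ℕ) : ℝ) = |(b : ℝ)| := by
    rw [Nat.cast_natAbs, Int.cast_abs]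
  unfold quarticWeight
  push_cast
  rw [hab]
  field_simp

lemma quarticSum_mul (d r : ℕ) [NeZero d] [NeZero r] (a : ℤ) :
    quarticSum (d * r) (d * a) = d * quarticSum r a := by
  have hd : (d : ℝ) ≠ 0 := by exact_mod_cast NeZero.ne d
  have hr : (r : ℝ) ≠ 0 := by exact_mod_cast NeZero.ne r
  have hperiodic : ∀ k : ℕ, ∑ x ∈ Finset.range (k * r), e ((a : ℝ) * (x : ℝ) ^ 4 / r) =
      k * quarticSum r a := by
    intro k
    induction k with
    | zero => simp
    | succ k ih =>
      rw [add_mul, one_mul, Finset.sum_range_add, ih]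
      push_cast
      rw [add_mul, one_mul]
      congr 1
      refine Finset.sum_congr rfl fun x _ => ?_
      have := e_quartic_eq_stdAddChar r a (k * r + x)
      push_cast at this
      rw [this, e_quartic_eq_stdAddChar]
      simp
  rw [← hperiodic]
  unfold quarticSum
  refine Finset.sum_congr rfl fun x _ => ?_
  congr 1
  push_cast
  field_simp

lemma sum_norm_quarticSum_pow_four_le (q : ℕ) [NeZero q] :
    ∑ u ∈ Finset.range q, ‖quarticSum q u‖ ^ 4 ≤ (q : ℝ) ^ 4 * quarticEnergyBound q := by
  have hq0 : q ≠ 0 := NeZero.ne q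
  calc _ = ∑ d ∈ q.divisors, ∑ u ∈ (Finset.range q).filter (fun u => q.gcd u = d),
        ‖quarticSum q u‖ ^ 4 :=
        (Finset.sum_fiberwise_of_maps_to
          (fun u _ => Nat.mem_divisors.2 ⟨Nat.gcd_dvd_left q u, hq0⟩) _).symm
    _ ≤ ∑ d ∈ q.divisors, (q : ℝ) ^ 4 * (((q / d : ℕ) : ℝ) * quarticWeight (q / d) ^ 2) := by
        refine Finset.sum_le_sum fun d hd => ?_
        obtain ⟨r, hr⟩ := Nat.dvd_of_mem_divisors hd
        have hd0 : d ≠ 0 := by rintro rfl; simp [hr] at hq0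
        have hr0 : r ≠ 0 := by rintro rfl; simp [hr] at hq0
        have : NeZero d := ⟨hd0⟩
        have : NeZero r := ⟨hr0⟩
        have hdiv : q / d = r := by rw [hr, Nat.mul_div_cancel_left _ (Nat.pos_of_ne_zero hd0)]
        have hterm : ∀ u ∈ (Finset.range q).filter (fun u => q.gcd u = d),
            ‖quarticSum q u‖ ^ 4 ≤ (q : ℝ) ^ 4 * quarticWeight (q / d) ^ 2 := by
          intro u hu
          have hg := (Finset.mem_filter.1 hu).2
          obtain ⟨v, rfl⟩ : d ∣ u := hg ▸ Nat.gcd_dvd_right q u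
          have hcop : v.Coprime r := by
            rw [hr, Nat.gcd_mul_left] at hg
            exact Nat.Coprime.symm (Nat.eq_of_mul_eq_mul_left (Nat.pos_of_ne_zero hd0)
              (hg.trans (mul_one d).symm))
          have hb := norm_quarticSum_sq_le r 1 one_ne_zero v (by
            rw [Int.cast_natCast]
            exact (ZMod.isUnit_iff_coprime v r).2 hcop)
          have hS : quarticSum q ((d * v : ℕ) : ℤ) = d * quarticSum r (1 * v) := by
            rw [one_mul, ← quarticSum_mul, hr]
            push_cast
            rfl
          rw [hS, norm_mul, Complex.norm_natCast, mul_pow, hdiv, hr]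
          have h4 : ‖quarticSum r (1 * v)‖ ^ 4 ≤ ((r : ℝ) ^ 2 * quarticWeight r) ^ 2 := by
            rw [show (4 : ℕ) = 2 * 2 from rfl, pow_mul]
            gcongr
            simpa using hb
          calc _ ≤ (d : ℝ) ^ 4 * ((r : ℝ) ^ 2 * quarticWeight r) ^ 2 := by gcongr
            _ = _ := by push_cast; ring
        refine (Finset.sum_le_card_nsmul _ _ _ hterm).trans ?_
        rw [← Nat.totient_div_of_dvd (Nat.dvd_of_mem_divisors hd), nsmul_eq_mul]
        have : ((q / d).totient : ℝ) ≤ ((q / d : ℕ) : ℝ) := by exact_mod_cast Nat.totient_le _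
        calc _ ≤ ((q / d : ℕ) : ℝ) * ((q : ℝ) ^ 4 * quarticWeight (q / d) ^ 2) := by gcongr
          _ = _ := by ring
    _ = _ := by
        rw [← Finset.mul_sum, Nat.sum_div_divisors q fun d => (d : ℝ) * quarticWeight d ^ 2]
        rfl

lemma card_quartic_energy_le (q : ℕ) [NeZero q] :
    (q : ℝ) * ((Finset.univ.filter fun z : (ZMod q × ZMod q) × (ZMod q × ZMod q) =>
      z.1.1 ^ 4 + z.1.2 ^ 4 = z.2.1 ^ 4 + z.2.2 ^ 4).card : ℝ) ≤
      (q : ℝ) ^ 4 * quarticEnergyBound q := by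
  have h := sum_norm_sq_eq_card q (Finset.univ : Finset (ZMod q × ZMod q))
    fun z => z.1 ^ 4 + z.2 ^ 4
  rw [Finset.univ_product_univ] at h
  rw [← h]
  refine le_trans (le_of_eq ?_) (sum_norm_quarticSum_pow_four_le q)
  rw [← sum_range_eq_sum_zmod]
  refine Finset.sum_congr rfl fun u _ => ?_
  have hpow : ∀ t : ℂ, ‖t‖ ^ 4 = ‖t * t‖ ^ 2 := fun t => by rw [norm_mul]; ring
  rw [quarticSum_eq, hpow, Finset.sum_mul_sum, ← Finset.univ_product_univ, Finset.sum_product]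
  congr 2
  refine Finset.sum_congr rfl fun x _ => Finset.sum_congr rfl fun y _ => ?_
  rw [mul_add, AddChar.map_add_eq_mul]
  push_cast
  rfl

lemma card_zmod_mul_eq_le (q : ℕ) [NeZero q] (b : ℤ) (hb : b ≠ 0) (v : ZMod q) :
    (Finset.univ.filter fun u : ZMod q => (b : ZMod q) * u = v).card ≤ b.natAbs := by
  rcases (Finset.univ.filter fun u : ZMod q => (b : ZMod q) * u = v).eq_empty_or_nonempty
    with h | ⟨u₀, hu₀⟩
  · rw [h]; simp
  simp only [Finset.mem_filter, Finset.mem_univ, true_and] at hu₀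
  refine le_trans ?_ (card_zmod_mul_eq_zero_le q b hb)
  refine Finset.card_le_card_of_injOn (fun u => u - u₀) ?_ (fun a _ b _ hab => by simpa using hab)
  intro u hu
  simp only [Finset.coe_filter, Finset.mem_univ, true_and, Set.mem_ofPred_eq] at hu ⊢
  rw [mul_sub, hu, hu₀, sub_self]

lemma sum_zmod_comp_mul_le (q : ℕ) [NeZero q] (b : ℤ) (hb : b ≠ 0) (F : ZMod q → ℝ)
    (hF : ∀ u, 0 ≤ F u) :
    ∑ u : ZMod q, F ((b : ZMod q) * u) ≤ |(b : ℝ)| * ∑ u : ZMod q, F u := by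
  rw [← Finset.sum_fiberwise_of_maps_to (t := Finset.univ) (g := fun u => (b : ZMod q) * u)
    (fun _ _ => Finset.mem_univ _), Finset.mul_sum]
  refine Finset.sum_le_sum fun v _ => ?_
  rw [Finset.sum_congr rfl (g := fun _ => F v) (fun u hu => by
    rw [(Finset.mem_filter.1 hu).2]), Finset.sum_const, nsmul_eq_mul]
  refine mul_le_mul_of_nonneg_right ?_ (hF v)
  have h := card_zmod_mul_eq_le q b hb v
  rw [← Int.cast_abs, ← Nat.cast_natAbs]
  exact_mod_cast h

lemma card_Icc_class_le (q N : ℕ) [NeZero q] (a : ZMod q) :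
    ((Finset.Icc 1 N).filter fun x : ℕ => (x : ZMod q) = a).card ≤ N / q + 1 := by
  rw [← Finset.card_range (N / q + 1)]
  apply Finset.card_le_card_of_injOn (fun x => x / q)
  · intro x hx
    simp only [Finset.coe_filter, Finset.mem_Icc, Set.mem_ofPred_eq] at hx
    simp only [Finset.coe_range, Set.mem_Iio]
    exact Nat.lt_succ_of_le (Nat.div_le_div_right hx.1.2)
  · intro x hx y hy hxy
    simp only [Finset.coe_filter, Set.mem_ofPred_eq] at hx hy hxy
    have hmod := (ZMod.natCast_eq_natCast_iff' _ _ _).1 (hx.2.trans hy.2.symm)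
    rw [← Nat.div_add_mod x q, ← Nat.div_add_mod y q, hxy, hmod]

lemma card_quartic_congruence_le (q N : ℕ) [NeZero q] (s : Finset ℕ) (hs : s ⊆ Finset.Icc 1 N) :
    (((s ×ˢ s) ×ˢ (s ×ˢ s)).filter fun z => (z.1.1 : ZMod q) ^ 4 + (z.1.2 : ZMod q) ^ 4 =
      (z.2.1 : ZMod q) ^ 4 + (z.2.2 : ZMod q) ^ 4).card ≤
    (N / q + 1) ^ 4 * (Finset.univ.filter fun z : (ZMod q × ZMod q) × (ZMod q × ZMod q) =>
      z.1.1 ^ 4 + z.1.2 ^ 4 = z.2.1 ^ 4 + z.2.2 ^ 4).card := by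
  refine Finset.card_le_mul_card_image_of_maps_to
    (f := fun z => (((z.1.1 : ZMod q), (z.1.2 : ZMod q)), ((z.2.1 : ZMod q), (z.2.2 : ZMod q))))
    ?_ _ ?_
  · intro z hz
    simpa using (Finset.mem_filter.1 hz).2
  · rintro ⟨⟨a, b⟩, ⟨c, d⟩⟩ _
    have hcard : ∀ a : ZMod q, (s.filter fun x : ℕ => (x : ZMod q) = a).card ≤ N / q + 1 :=
      fun a => (Finset.card_le_card (Finset.filter_subset_filter _ hs)).trans
        (card_Icc_class_le q N a)
    calc _ ≤ (((s.filter fun x : ℕ => (x : ZMod q) = a) ×ˢ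
          (s.filter fun x : ℕ => (x : ZMod q) = b)) ×ˢ
          ((s.filter fun x : ℕ => (x : ZMod q) = c) ×ˢ
          (s.filter fun x : ℕ => (x : ZMod q) = d))).card := by
          apply Finset.card_le_card
          rintro ⟨⟨x, y⟩, ⟨z, w⟩⟩ hz
          simp only [Finset.mem_filter, Finset.mem_product, Prod.mk.injEq] at hz ⊢
          tauto
      _ ≤ ((N / q + 1) * (N / q + 1)) * ((N / q + 1) * (N / q + 1)) := by
          simp only [Finset.card_product]
          gcongr <;> exact hcard _
      _ = _ := by ring

lemma smoothA_subset (P R : ℝ) : smoothA P R ⊆ Finset.Icc 1 ⌊P⌋₊ := Finset.filter_subset _ _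

lemma norm_h_le {P : ℝ} (hP : 0 ≤ P) (R α : ℝ) : ‖h P R α‖ ≤ P := by
  refine (norm_sum_le _ _).trans ?_
  simp only [norm_e, Finset.sum_const, nsmul_eq_mul, mul_one]
  refine le_trans ?_ (Nat.floor_le hP)
  have := Finset.card_le_card (smoothA_subset P R)
  rw [Nat.card_Icc, Nat.add_sub_cancel] at this
  exact_mod_cast this

lemma norm_h_pow_four_eq (P R γ : ℝ) (m : ℕ) [NeZero m] (t : ℤ) :
    ‖h P R ((t : ℝ) / m + γ)‖ ^ 4 =
      ‖∑ z ∈ smoothA P R ×ˢ smoothA P R, e (γ * ((z.1 : ℝ) ^ 4 + (z.2 : ℝ) ^ 4)) *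
        ZMod.stdAddChar ((t : ZMod m) * ((z.1 : ZMod m) ^ 4 + (z.2 : ZMod m) ^ 4))‖ ^ 2 := by
  have hpow : ∀ t : ℂ, ‖t‖ ^ 4 = ‖t * t‖ ^ 2 := fun t => by rw [norm_mul]; ring
  rw [hpow]
  unfold h
  rw [Finset.sum_mul_sum, Finset.sum_product]
  congr 2
  refine Finset.sum_congr rfl fun x _ => Finset.sum_congr rfl fun y _ => ?_
  simp only
  rw [mul_add (t : ZMod m), AddChar.map_add_eq_mul, ← e_quartic_eq_stdAddChar,
    ← e_quartic_eq_stdAddChar, ← e_add, ← e_add, ← e_add]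
  congr 1
  ring

/-- The fourth moment of the smooth Weyl sum over fractions of a fixed denominator. -/
lemma sum_norm_h_pow_four_le (A : ℚ) (hA : A ≠ 0) {P : ℝ} (R : ℝ) (q : ℕ) [NeZero q]
    (hq : (q : ℝ) ≤ P) (γ : ℝ) :
    ∑ a ∈ Finset.range (q + 1), ‖h P R ((A : ℝ) * ((a : ℝ) / q) + γ)‖ ^ 4 ≤
      32 * |(A.num : ℝ)| * A.den * P ^ 4 * quarticEnergyBound q := by
  have hq0 : (0 : ℝ) < q := by exact_mod_cast Nat.pos_of_ne_zero (NeZero.ne q)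
  have hP0 : 0 < P := hq0.trans_le hq
  have hden : A.den ≠ 0 := A.den_nz
  have hden0 : (0 : ℝ) < A.den := by exact_mod_cast A.den_pos
  set m : ℕ := A.den * q with hm
  have : NeZero m := ⟨mul_ne_zero hden (NeZero.ne q)⟩
  set s := smoothA P R with hs
  set Ψ : ZMod m → ℝ := fun u => ‖∑ z ∈ s ×ˢ s, e (γ * ((z.1 : ℝ) ^ 4 + (z.2 : ℝ) ^ 4)) *
        ZMod.stdAddChar (u * ((z.1 : ZMod m) ^ 4 + (z.2 : ZMod m) ^ 4))‖ ^ 2 with hΨ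
  have hterm : ∀ a : ℕ, ‖h P R ((A : ℝ) * ((a : ℝ) / q) + γ)‖ ^ 4 =
      Ψ ((A.num : ZMod m) * (a : ZMod m)) := by
    intro a
    have h1 : (A : ℝ) * ((a : ℝ) / q) = ((A.num * a : ℤ) : ℝ) / m := by
      rw [Rat.cast_def, hm]
      push_cast
      field_simp
    rw [h1, norm_h_pow_four_eq]
    push_cast
    rfl
  have hΨ0 : ∀ u, 0 ≤ Ψ u := fun u => by positivity
  have hmean : ∑ u : ZMod m, Ψ u ≤ m * ((((s ×ˢ s) ×ˢ (s ×ˢ s)).filter fun z =>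
      (z.1.1 : ZMod q) ^ 4 + (z.1.2 : ZMod q) ^ 4 =
      (z.2.1 : ZMod q) ^ 4 + (z.2.2 : ZMod q) ^ 4).card : ℝ) := by
    refine (sum_norm_sq_le m (s ×ˢ s) (fun z => (z.1 : ZMod m) ^ 4 + (z.2 : ZMod m) ^ 4)
      (fun z => e (γ * ((z.1 : ℝ) ^ 4 + (z.2 : ℝ) ^ 4))) fun _ => (norm_e _).le).trans ?_
    gcongr with z hz
    intro hz
    have := congrArg (ZMod.castHom (Dvd.intro_left A.den rfl : q ∣ m) (ZMod q)) hz
    simpa only [map_add, map_pow, map_natCast] using this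
  have hcount := card_quartic_congruence_le q ⌊P⌋₊ s (smoothA_subset P R)
  have hk : ((⌊P⌋₊ / q + 1 : ℕ) : ℝ) ≤ 2 * P / q := by
    have h1 : ((⌊P⌋₊ / q : ℕ) : ℝ) ≤ P / q :=
      Nat.cast_div_le.trans (by gcongr; exact Nat.floor_le hP0.le)
    have h2 : 1 ≤ P / q := (one_le_div hq0).2 hq
    push_cast
    rw [mul_div_assoc]
    linarith
  set Q := (Finset.univ.filter fun z : (ZMod q × ZMod q) × (ZMod q × ZMod q) =>
      z.1.1 ^ 4 + z.1.2 ^ 4 = z.2.1 ^ 4 + z.2.2 ^ 4).card with hQ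
  have hcount' : ((((s ×ˢ s) ×ˢ (s ×ˢ s)).filter fun z =>
      (z.1.1 : ZMod q) ^ 4 + (z.1.2 : ZMod q) ^ 4 =
      (z.2.1 : ZMod q) ^ 4 + (z.2.2 : ZMod q) ^ 4).card : ℝ) ≤ (2 * P / q) ^ 4 * Q := by
    calc _ ≤ (((⌊P⌋₊ / q + 1) ^ 4 * Q : ℕ) : ℝ) := by exact_mod_cast hcount
      _ = ((⌊P⌋₊ / q + 1 : ℕ) : ℝ) ^ 4 * Q := by push_cast; rfl
      _ ≤ _ := by gcongr
  have hE : (q : ℝ) * Q ≤ (q : ℝ) ^ 4 * quarticEnergyBound q := card_quartic_energy_le q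
  have hqm : q + 1 ≤ m + m := by
    have h1 : q ≤ m := Nat.le_mul_of_pos_left q A.den_pos
    have h2 := Nat.pos_of_ne_zero (NeZero.ne q)
    omega
  calc ∑ a ∈ Finset.range (q + 1), ‖h P R ((A : ℝ) * ((a : ℝ) / q) + γ)‖ ^ 4
      = ∑ a ∈ Finset.range (q + 1), Ψ ((A.num : ZMod m) * (a : ZMod m)) :=
        Finset.sum_congr rfl fun a _ => hterm a
    _ ≤ ∑ a ∈ Finset.range (m + m), Ψ ((A.num : ZMod m) * (a : ZMod m)) :=
        Finset.sum_le_sum_of_subset_of_nonneg (Finset.range_mono hqm) fun _ _ _ => hΨ0 _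
    _ = 2 * ∑ u : ZMod m, Ψ ((A.num : ZMod m) * u) := by
        rw [Finset.sum_range_add, two_mul]
        simp only [Nat.cast_add, ZMod.natCast_self, zero_add]
        rw [sum_range_eq_sum_zmod m fun u => Ψ ((A.num : ZMod m) * u)]
    _ ≤ 2 * (|(A.num : ℝ)| * ∑ u : ZMod m, Ψ u) := by
        gcongr
        exact sum_zmod_comp_mul_le m A.num (Rat.num_ne_zero.2 hA) Ψ hΨ0
    _ ≤ 2 * (|(A.num : ℝ)| * (m * ((2 * P / q) ^ 4 * Q))) := by
        gcongr
        exact hmean.trans (by gcongr)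
    _ = 32 * |(A.num : ℝ)| * A.den * P ^ 4 * ((q : ℝ) * Q / (q : ℝ) ^ 4) := by
        rw [hm]
        push_cast
        ring
    _ ≤ _ := by
        gcongr
        rw [div_le_iff₀ (by positivity), mul_comm _ ((q : ℝ) ^ 4)]
        exact hE

open Finset in
lemma sum_range_mul_eq_by_parts (φ c : ℕ → ℂ) (n : ℕ) :
    ∑ i ∈ range n, φ i * c i = φ n * ∑ i ∈ range n, c i -
      ∑ i ∈ range n, (φ (i + 1) - φ i) * ∑ j ∈ range (i + 1), c j := by
  induction n with
  | zero => simp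
  | succ n ih =>
    rw [sum_range_succ, ih, sum_range_succ (fun i => (φ (i + 1) - φ i) * _), sum_range_succ c n]
    ring

open Finset in
lemma norm_sum_range_mul_le (φ c : ℕ → ℂ) (n : ℕ) (B : ℝ)
    (hB : ∀ k ≤ n, ‖∑ i ∈ range k, c i‖ ≤ B) :
    ‖∑ i ∈ range n, φ i * c i‖ ≤ B * (‖φ n‖ + ∑ i ∈ range n, ‖φ (i + 1) - φ i‖) := by
  rw [sum_range_mul_eq_by_parts, mul_add]
  refine (norm_sub_le _ _).trans (add_le_add ?_ ?_)
  · rw [norm_mul, mul_comm]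
    gcongr
    exact hB n le_rfl
  · rw [mul_sum]
    refine (norm_sum_le _ _).trans (sum_le_sum fun i hi => ?_)
    rw [norm_mul, mul_comm]
    gcongr
    exact hB _ (mem_range.1 hi)

open Finset in
lemma sum_range_shift_eq_of_periodic (w : ℕ → ℂ) (q : ℕ) (hw : ∀ x, w (x + q) = w x) (m : ℕ) :
    ∑ i ∈ range q, w (m + i) = ∑ i ∈ range q, w i := by
  induction m with
  | zero => simp
  | succ m ih =>
    rw [← ih]
    have h1 := sum_range_succ (fun i => w (m + i)) q
    have h2 := sum_range_succ' (fun i => w (m + i)) q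
    have h3 : ∑ i ∈ range q, w (m + 1 + i) = ∑ i ∈ range q, w (m + (i + 1)) :=
      sum_congr rfl fun i _ => by congr 1; ring
    rw [h3]
    rw [hw] at h1
    rw [h1, add_zero] at h2
    exact (add_right_cancel h2).symm

open Finset in
lemma norm_sum_sub_mean_le (w : ℕ → ℂ) (q : ℕ) (hq : 0 < q) (hw : ∀ x, w (x + q) = w x)
    (hw1 : ∀ x, ‖w x‖ ≤ 1) (m n : ℕ) :
    ‖∑ i ∈ range n, (w (m + i) - (∑ j ∈ range q, w j) / q)‖ ≤ 2 * q := by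
  have hq0 : (q : ℂ) ≠ 0 := by exact_mod_cast hq.ne'
  have hμ : ‖(∑ j ∈ range q, w j) / q‖ ≤ 1 := by
    rw [norm_div, Complex.norm_natCast]
    refine div_le_one_of_le₀ ((norm_sum_le _ _).trans ?_) (by positivity)
    refine (sum_le_sum fun x _ => hw1 x).trans (by simp)
  induction n using Nat.strong_induction_on generalizing m with
  | _ n ih =>
    rcases lt_or_ge n q with hn | hn
    · refine (norm_sum_le _ _).trans ((sum_le_sum fun x _ =>
        (norm_sub_le _ _).trans (add_le_add (hw1 _) hμ)).trans ?_)
      rw [sum_const, card_range, nsmul_eq_mul]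
      have : (n : ℝ) ≤ q := by exact_mod_cast hn.le
      linarith
    · obtain ⟨k, rfl⟩ := Nat.exists_eq_add_of_le hn
      rw [sum_range_add, sum_sub_distrib, sum_range_shift_eq_of_periodic w q hw, sum_const,
        card_range, nsmul_eq_mul, mul_div_cancel₀ _ hq0, sub_self, zero_add]
      have := ih k (by omega) (m + q)
      simpa only [add_assoc] using this

lemma e_eq_exp (t : ℝ) : e t = Complex.exp (Complex.I * ((2 * Real.pi * t : ℝ) : ℂ)) := by
  unfold e
  push_cast
  ring_nf

lemma norm_e_sub_e_le (s t : ℝ) : ‖e s - e t‖ ≤ 2 * Real.pi * |s - t| := by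
  have h1 : e s - e t = e t * (e (s - t) - 1) := by
    rw [mul_sub, ← e_add, mul_one]
    congr 2
    ring
  rw [h1, norm_mul, norm_e, one_mul, e_eq_exp]
  refine Real.norm_exp_I_mul_ofReal_sub_one_le.trans ?_
  rw [Real.norm_eq_abs, abs_mul, abs_of_pos (by positivity : 0 < 2 * Real.pi)]

lemma norm_exp_I_mul_sub_one_sub_le (y : ℝ) :
    ‖Complex.exp (Complex.I * y) - 1 - Complex.I * y‖ ≤ 3 * y ^ 2 := by
  have hn : ‖Complex.I * (y : ℂ)‖ = |y| := by simp
  rcases le_or_gt |y| 1 with hy | hy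
  · have := Complex.norm_exp_sub_one_sub_id_le (x := Complex.I * y) (by rwa [hn])
    rw [hn, sq_abs] at this
    nlinarith [sq_nonneg y]
  · have h1 : ‖Complex.exp (Complex.I * y) - 1‖ ≤ |y| := Real.norm_exp_I_mul_ofReal_sub_one_le
    have h2 := norm_sub_le (Complex.exp (Complex.I * y) - 1) (Complex.I * (y : ℂ))
    rw [hn] at h2
    nlinarith [sq_abs y]

lemma norm_e_sub_one_sub_le (t : ℝ) :
    ‖e t - 1 - Complex.I * ((2 * Real.pi * t : ℝ) : ℂ)‖ ≤ 3 * (2 * Real.pi * t) ^ 2 := by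
  rw [e_eq_exp]
  exact norm_exp_I_mul_sub_one_sub_le _

open Finset in
lemma sum_norm_e_quartic_sub_le (γ : ℝ) (m n : ℕ) {P : ℝ} (hP : 1 ≤ P) (hmn : (m : ℝ) + n ≤ P + 1) :
    ∑ i ∈ range n, ‖e (γ * ((m + (i + 1) : ℕ) : ℝ) ^ 4) - e (γ * ((m + i : ℕ) : ℝ) ^ 4)‖ ≤
      32 * Real.pi * (P ^ 4 * |γ|) := by
  have h1 : ∀ i ∈ range n,
      ‖e (γ * ((m + (i + 1) : ℕ) : ℝ) ^ 4) - e (γ * ((m + i : ℕ) : ℝ) ^ 4)‖ ≤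
      2 * Real.pi * |γ| * (((m + (i + 1) : ℕ) : ℝ) ^ 4 - ((m + i : ℕ) : ℝ) ^ 4) := by
    intro i _
    refine (norm_e_sub_e_le _ _).trans_eq ?_
    have h0 : 0 ≤ ((m + (i + 1) : ℕ) : ℝ) ^ 4 - ((m + i : ℕ) : ℝ) ^ 4 := by
      rw [sub_nonneg]
      gcongr
      omega
    rw [← mul_sub, abs_mul, abs_of_nonneg h0]
    ring
  refine (sum_le_sum h1).trans ?_
  rw [← mul_sum, sum_range_sub (fun i => ((m + i : ℕ) : ℝ) ^ 4)]
  have h2 : ((m + n : ℕ) : ℝ) ^ 4 - ((m + 0 : ℕ) : ℝ) ^ 4 ≤ (2 * P) ^ 4 := by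
    have : ((m + n : ℕ) : ℝ) ^ 4 ≤ (2 * P) ^ 4 := by
      gcongr
      push_cast
      linarith
    have h3 : (0 : ℝ) ≤ ((m + 0 : ℕ) : ℝ) ^ 4 := by positivity
    linarith
  calc _ ≤ 2 * Real.pi * |γ| * (2 * P) ^ 4 := by gcongr
    _ = _ := by ring

lemma norm_e_quartic_sub_le {γ x : ℝ} (hγ : γ ≠ 0) (hx : 1 ≤ x) :
    ‖e (γ * x ^ 4) - ((8 * Real.pi * γ * x ^ 3 : ℝ) * Complex.I : ℂ)⁻¹ *
      (e (γ * (x + 1) ^ 4) - e (γ * x ^ 4))‖ ≤ 1200 * |γ| * x ^ 3 + 3 / x := by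
  have hx0 : 0 < x := by linarith
  have hγ0 : 0 < |γ| := abs_pos.2 hγ
  set D : ℂ := ((8 * Real.pi * γ * x ^ 3 : ℝ) : ℂ) * Complex.I with hD
  set t : ℝ := γ * ((x + 1) ^ 4 - x ^ 4) with ht
  have hπ := Real.pi_pos
  have hDn : ‖D‖ = 8 * Real.pi * |γ| * x ^ 3 := by
    rw [hD, norm_mul, Complex.norm_I, mul_one, Complex.norm_real, Real.norm_eq_abs, abs_mul,
      abs_mul, abs_of_pos (by positivity : 0 < 8 * Real.pi), abs_of_pos (by positivity : 0 < x ^ 3)]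
  have hDpos : 0 < ‖D‖ := by rw [hDn]; positivity
  have hD0 : D ≠ 0 := norm_pos_iff.1 hDpos
  have h1 : e (γ * (x + 1) ^ 4) = e (γ * x ^ 4) * e t := by
    rw [← e_add]; congr 1; rw [ht]; ring
  have h2 : e (γ * x ^ 4) - D⁻¹ * (e (γ * (x + 1) ^ 4) - e (γ * x ^ 4)) =
      e (γ * x ^ 4) * (D⁻¹ * -((e t - 1 - Complex.I * ((2 * Real.pi * t : ℝ) : ℂ)) +
        ((2 * Real.pi * (t - 4 * γ * x ^ 3) : ℝ) : ℂ) * Complex.I)) := by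
    rw [h1]
    have : D = ((8 * Real.pi * γ * x ^ 3 : ℝ) : ℂ) * Complex.I := rfl
    have h3 : -((e t - 1 - Complex.I * ((2 * Real.pi * t : ℝ) : ℂ)) +
        ((2 * Real.pi * (t - 4 * γ * x ^ 3) : ℝ) : ℂ) * Complex.I) = D - (e t - 1) := by
      rw [this]; push_cast; ring
    rw [h3, mul_sub D⁻¹ D, inv_mul_cancel₀ hD0]
    ring
  have hpoly : (x + 1) ^ 4 - x ^ 4 = 4 * x ^ 3 + 6 * x ^ 2 + 4 * x + 1 := by ring
  have ht1 : |t| ≤ |γ| * (15 * x ^ 3) := by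
    rw [ht, abs_mul, hpoly, abs_of_pos (by positivity : 0 < 4 * x ^ 3 + 6 * x ^ 2 + 4 * x + 1)]
    gcongr
    nlinarith [one_le_pow₀ hx (n := 2), one_le_pow₀ hx (n := 3), mul_nonneg hx0.le (sub_nonneg.2 hx),
      mul_nonneg (sq_nonneg x) (sub_nonneg.2 hx)]
  have ht2 : |t - 4 * γ * x ^ 3| ≤ |γ| * (11 * x ^ 2) := by
    rw [ht, hpoly, show γ * (4 * x ^ 3 + 6 * x ^ 2 + 4 * x + 1) - 4 * γ * x ^ 3 =
      γ * (6 * x ^ 2 + 4 * x + 1) by ring, abs_mul,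
      abs_of_pos (by positivity : 0 < 6 * x ^ 2 + 4 * x + 1)]
    gcongr
    nlinarith
  rw [h2, norm_mul, norm_e, one_mul, norm_mul, norm_inv, norm_neg, inv_mul_le_iff₀ hDpos, hDn]
  refine (norm_add_le _ _).trans ((add_le_add (norm_e_sub_one_sub_le t) le_rfl).trans ?_)
  rw [norm_mul, Complex.norm_I, mul_one, Complex.norm_real, Real.norm_eq_abs, abs_mul,
    abs_of_pos (by positivity : 0 < 2 * Real.pi)]
  have h4 : t ^ 2 ≤ (|γ| * (15 * x ^ 3)) ^ 2 := by rw [← sq_abs]; gcongr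
  have hπ4 : Real.pi ≤ 3.15 := Real.pi_lt_d2.le
  calc 3 * (2 * Real.pi * t) ^ 2 + 2 * Real.pi * |t - 4 * γ * x ^ 3|
      = Real.pi * (12 * Real.pi * t ^ 2 + 2 * |t - 4 * γ * x ^ 3|) := by ring
    _ ≤ Real.pi * (12 * 3.15 * (|γ| * (15 * x ^ 3)) ^ 2 + 2 * (|γ| * (11 * x ^ 2))) := by gcongr
    _ ≤ Real.pi * (9600 * (|γ| * x ^ 3) ^ 2 + 24 * (|γ| * x ^ 2)) := by
        refine mul_le_mul_of_nonneg_left ?_ hπ.le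
        nlinarith [sq_nonneg (|γ| * x ^ 3), mul_pos hγ0 (pow_pos hx0 2)]
    _ = 8 * Real.pi * |γ| * x ^ 3 * (1200 * |γ| * x ^ 3 + 3 / x) := by
        field_simp
        ring

open Finset in
lemma norm_sum_e_quartic_le_of_ne_zero {γ δ P : ℝ} (hγ : γ ≠ 0) (hδ : 0 < δ) (hP : 0 < P) (m n : ℕ)
    (hm1 : 1 ≤ m) (hm : δ * P ≤ m) (hmn : (m : ℝ) + n ≤ P + 1) :
    ‖∑ i ∈ range n, e (γ * ((m + i : ℕ) : ℝ) ^ 4)‖ ≤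
      1 / (δ ^ 3 * (P ^ 3 * |γ|)) + 1200 * (P ^ 4 * |γ|) + 3 / δ := by
  have hγ0 : 0 < |γ| := abs_pos.2 hγ
  have hπ := Real.pi_pos
  have hm1' : (1 : ℝ) ≤ m := by exact_mod_cast hm1
  have hnP : (n : ℝ) ≤ P := by linarith
  set φ : ℕ → ℂ := fun i => ((8 * Real.pi * γ * ((m + i : ℕ) : ℝ) ^ 3 : ℝ) * Complex.I : ℂ)⁻¹ with hφ
  set c : ℕ → ℂ := fun i => e (γ * ((m + (i + 1) : ℕ) : ℝ) ^ 4) - e (γ * ((m + i : ℕ) : ℝ) ^ 4) with hc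
  set r : ℕ → ℝ := fun i => (((m + i : ℕ) : ℝ) ^ 3)⁻¹ with hr
  set κ : ℂ := ((8 * Real.pi * γ : ℝ) * Complex.I : ℂ)⁻¹ with hκ
  have hφr : ∀ i, φ i = κ * (r i : ℂ) := by
    intro i
    simp only [hφ, hκ, hr]
    push_cast
    rw [← mul_inv]
    congr 1
    ring
  have hκn : ‖κ‖ = (8 * Real.pi * |γ|)⁻¹ := by
    rw [hκ, norm_inv, norm_mul, Complex.norm_I, mul_one, Complex.norm_real, Real.norm_eq_abs, abs_mul,
      abs_of_pos (by positivity : 0 < 8 * Real.pi)]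
  have hrpos : ∀ i, 0 ≤ r i := fun i => by positivity
  have hranti : ∀ i, r (i + 1) ≤ r i := by
    intro i
    simp only [hr]
    have : (0 : ℝ) < ((m + i : ℕ) : ℝ) := by exact_mod_cast (by omega : 0 < m + i)
    gcongr
    omega
  have hmain : ‖∑ i ∈ range n, φ i * c i‖ ≤ 1 / (δ ^ 3 * (P ^ 3 * |γ|)) := by
    refine (norm_sum_range_mul_le φ c n 2 ?_).trans ?_
    · intro k _
      rw [hc, sum_range_sub (fun i => e (γ * ((m + i : ℕ) : ℝ) ^ 4))]
      refine (norm_sub_le _ _).trans ?_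
      rw [norm_e, norm_e]
      norm_num
    · have h1 : ‖φ n‖ + ∑ i ∈ range n, ‖φ (i + 1) - φ i‖ = ‖κ‖ * r 0 := by
        have h2 : ∀ i, ‖φ (i + 1) - φ i‖ = ‖κ‖ * (r i - r (i + 1)) := by
          intro i
          rw [hφr, hφr, ← mul_sub, norm_mul, ← Complex.ofReal_sub, Complex.norm_real,
            Real.norm_eq_abs, abs_sub_comm, abs_of_nonneg (sub_nonneg.2 (hranti i))]
        rw [sum_congr rfl fun i _ => h2 i, ← mul_sum, sum_range_sub', hφr, norm_mul,
          Complex.norm_real, Real.norm_eq_abs, abs_of_nonneg (hrpos n)]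
        ring
      have h3 : r 0 ≤ ((δ * P) ^ 3)⁻¹ := by
        simp only [hr, add_zero]
        gcongr
      rw [h1, hκn]
      calc 2 * ((8 * Real.pi * |γ|)⁻¹ * r 0) ≤ 2 * ((8 * Real.pi * |γ|)⁻¹ * ((δ * P) ^ 3)⁻¹) := by
            gcongr
        _ = 1 / (δ ^ 3 * (P ^ 3 * |γ|)) * (4 * Real.pi)⁻¹ := by
            field_simp
            ring
        _ ≤ 1 / (δ ^ 3 * (P ^ 3 * |γ|)) * 1 := by
            gcongr
            refine inv_le_one_of_one_le₀ ?_
            linarith [Real.pi_gt_three]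
        _ = _ := mul_one _
  have herr : ‖∑ i ∈ range n, (e (γ * ((m + i : ℕ) : ℝ) ^ 4) - φ i * c i)‖ ≤
      1200 * (P ^ 4 * |γ|) + 3 / δ := by
    have h1 : ∀ i ∈ range n, ‖e (γ * ((m + i : ℕ) : ℝ) ^ 4) - φ i * c i‖ ≤
        1200 * |γ| * P ^ 3 + 3 / (δ * P) := by
      intro i hi
      have hx1 : (1 : ℝ) ≤ ((m + i : ℕ) : ℝ) := by exact_mod_cast (by omega : 1 ≤ m + i)
      have hxP : ((m + i : ℕ) : ℝ) ≤ P := by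
        have : ((i + 1 : ℕ) : ℝ) ≤ n := by exact_mod_cast mem_range.1 hi
        push_cast at this ⊢
        linarith
      have hxδ : δ * P ≤ ((m + i : ℕ) : ℝ) := by
        push_cast
        linarith [(Nat.cast_nonneg i : (0 : ℝ) ≤ i)]
      have h2 := norm_e_quartic_sub_le hγ hx1
      simp only [hφ, hc]
      rw [show ((m + (i + 1) : ℕ) : ℝ) = ((m + i : ℕ) : ℝ) + 1 by push_cast; ring]
      refine h2.trans ?_
      gcongr
    refine (norm_sum_le _ _).trans ((sum_le_sum h1).trans ?_)
    rw [sum_const, card_range, nsmul_eq_mul]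
    calc (n : ℝ) * (1200 * |γ| * P ^ 3 + 3 / (δ * P)) ≤ P * (1200 * |γ| * P ^ 3 + 3 / (δ * P)) := by
          gcongr
      _ = _ := by field_simp
  have hsplit : ∑ i ∈ range n, e (γ * ((m + i : ℕ) : ℝ) ^ 4) = ∑ i ∈ range n, φ i * c i +
      ∑ i ∈ range n, (e (γ * ((m + i : ℕ) : ℝ) ^ 4) - φ i * c i) := by
    rw [← sum_add_distrib]
    exact sum_congr rfl fun _ _ => by ring
  rw [hsplit]
  refine (norm_add_le _ _).trans ?_
  linarith

open Finset in
lemma norm_sum_e_quartic_le {δ P : ℝ} (hδ : 0 < δ) (hδ1 : δ ≤ 1) (hP : 0 < P) (γ : ℝ) (m n : ℕ)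
    (hm1 : 1 ≤ m) (hm : δ * P ≤ m) (hmn : (m : ℝ) + n ≤ P + 1) :
    ‖∑ i ∈ range n, e (γ * ((m + i : ℕ) : ℝ) ^ 4)‖ ≤
      1200 / δ ^ 3 * (P / (1 + P ^ 4 * |γ|) + (1 + P ^ 4 * |γ|)) := by
  have hm1' : (1 : ℝ) ≤ m := by exact_mod_cast hm1
  have hnP : (n : ℝ) ≤ P := by linarith
  have hδ3 : δ ^ 3 ≤ 1 := pow_le_one₀ hδ.le hδ1
  have hδ31 : δ ^ 3 ≤ δ := by simpa using pow_le_pow_of_le_one hδ.le hδ1 (by norm_num : 1 ≤ 3)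
  have hK : 1200 ≤ 1200 / δ ^ 3 := by rw [le_div_iff₀ (by positivity)]; linarith
  set T := P ^ 4 * |γ| with hT
  have hT0 : 0 ≤ T := by positivity
  rcases le_or_gt T 1 with h1 | h1
  · have h2 : ‖∑ i ∈ range n, e (γ * ((m + i : ℕ) : ℝ) ^ 4)‖ ≤ P := by
      refine (norm_sum_le _ _).trans ?_
      simpa [norm_e] using hnP
    refine h2.trans ?_
    have h3 : P / 2 ≤ P / (1 + T) := by gcongr; linarith
    calc P ≤ 1200 * (P / 2 + 0) := by linarith
      _ ≤ _ := by gcongr; linarith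
  · have hγ : γ ≠ 0 := by
      rintro rfl
      simp [hT] at h1
      linarith
    have hγ0 : 0 < |γ| := abs_pos.2 hγ
    refine (norm_sum_e_quartic_le_of_ne_zero hγ hδ hP m n hm1 hm hmn).trans ?_
    have h2 : 1 / (δ ^ 3 * (P ^ 3 * |γ|)) ≤ 1200 / δ ^ 3 * (P / (1 + T)) := by
      have : 1 / (δ ^ 3 * (P ^ 3 * |γ|)) = 1 / δ ^ 3 * (P / T) := by
        rw [hT]; field_simp
      rw [this]
      have h3 : P / T ≤ 2 * (P / (1 + T)) := by
        rw [div_le_iff₀ (by linarith), mul_assoc, div_mul_eq_mul_div, ← mul_div_assoc, le_div_iff₀ (by linarith)]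
        nlinarith
      calc 1 / δ ^ 3 * (P / T) ≤ 1 / δ ^ 3 * (2 * (P / (1 + T))) := by gcongr
        _ = 2 / δ ^ 3 * (P / (1 + T)) := by ring
        _ ≤ _ := by gcongr; norm_num
    have h4 : 3 / δ ≤ 1200 / δ ^ 3 := by gcongr; norm_num
    have h5 : 1200 * T ≤ 1200 / δ ^ 3 * T := by gcongr
    linarith

open Finset in
lemma norm_sum_periodic_mul_e_quartic_le (w : ℕ → ℂ) (q : ℕ) (hq : 0 < q)
    (hw : ∀ x, w (x + q) = w x) (hw1 : ∀ x, ‖w x‖ ≤ 1) {δ P : ℝ} (hδ : 0 < δ) (hδ1 : δ ≤ 1)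
    (hP : 1 ≤ P) (γ : ℝ) (m n : ℕ)
    (hm1 : 1 ≤ m) (hm : δ * P ≤ m) (hmn : (m : ℝ) + n ≤ P + 1) :
    ‖∑ i ∈ range n, e (γ * ((m + i : ℕ) : ℝ) ^ 4) * w (m + i)‖ ≤
      1402 / δ ^ 3 * (‖(∑ j ∈ range q, w j) / q‖ * P / (1 + P ^ 4 * |γ|) + q * (1 + P ^ 4 * |γ|)) := by
  have hP0 : 0 < P := by linarith
  have hq1 : (1 : ℝ) ≤ q := by exact_mod_cast hq
  set μ := (∑ j ∈ range q, w j) / q with hμ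
  have hμ1 : ‖μ‖ ≤ 1 := by
    rw [hμ, norm_div, Complex.norm_natCast]
    refine div_le_one_of_le₀ ((norm_sum_le _ _).trans ?_) (by positivity)
    refine (sum_le_sum fun x _ => hw1 x).trans (by simp)
  set T := P ^ 4 * |γ| with hT
  have hT0 : 0 ≤ T := by positivity
  have hδ3 : δ ^ 3 ≤ 1 := pow_le_one₀ hδ.le hδ1
  have hsplit : ∑ i ∈ range n, e (γ * ((m + i : ℕ) : ℝ) ^ 4) * w (m + i) =
      ∑ i ∈ range n, e (γ * ((m + i : ℕ) : ℝ) ^ 4) * (w (m + i) - μ) +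
      μ * ∑ i ∈ range n, e (γ * ((m + i : ℕ) : ℝ) ^ 4) := by
    rw [mul_sum, ← sum_add_distrib]
    exact sum_congr rfl fun _ _ => by ring
  have h1 : ‖∑ i ∈ range n, e (γ * ((m + i : ℕ) : ℝ) ^ 4) * (w (m + i) - μ)‖ ≤
      202 * (q * (1 + T)) := by
    refine (norm_sum_range_mul_le (fun i => e (γ * ((m + i : ℕ) : ℝ) ^ 4))
      (fun i => w (m + i) - μ) n (2 * q)
      (fun k _ => norm_sum_sub_mean_le w q hq hw hw1 m k)).trans ?_
    rw [norm_e]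
    have h2 := sum_norm_e_quartic_sub_le γ m n hP hmn
    rw [← hT] at h2
    calc _ ≤ 2 * (q : ℝ) * (1 + 32 * Real.pi * T) := by gcongr
      _ ≤ 2 * (q : ℝ) * (1 + 32 * 3.15 * T) := by gcongr; exact Real.pi_lt_d2.le
      _ ≤ 2 * (q : ℝ) * (101 * (1 + T)) := by gcongr; linarith
      _ = _ := by ring
  have h2 : ‖μ * ∑ i ∈ range n, e (γ * ((m + i : ℕ) : ℝ) ^ 4)‖ ≤
      1200 / δ ^ 3 * (‖μ‖ * P / (1 + T) + q * (1 + T)) := by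
    rw [norm_mul]
    calc _ ≤ ‖μ‖ * (1200 / δ ^ 3 * (P / (1 + T) + (1 + T))) := by
          gcongr
          exact norm_sum_e_quartic_le hδ hδ1 hP0 γ m n hm1 hm hmn
      _ = 1200 / δ ^ 3 * (‖μ‖ * P / (1 + T) + ‖μ‖ * (1 + T)) := by ring
      _ ≤ _ := by gcongr; linarith
  have h3 : 202 * (q * (1 + T)) ≤ 202 / δ ^ 3 * (‖μ‖ * P / (1 + T) + q * (1 + T)) := by
    have h4 : (202 : ℝ) ≤ 202 / δ ^ 3 := by rw [le_div_iff₀ (by positivity)]; linarith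
    have h5 : 0 ≤ ‖μ‖ * P / (1 + T) := by positivity
    calc 202 * (q * (1 + T)) ≤ 202 / δ ^ 3 * (q * (1 + T)) := by gcongr
      _ ≤ _ := by gcongr; linarith
  rw [hsplit]
  refine (norm_add_le _ _).trans ((add_le_add h1 h2).trans ?_)
  have h6 : 1402 / δ ^ 3 * (‖μ‖ * P / (1 + T) + q * (1 + T)) =
    202 / δ ^ 3 * (‖μ‖ * P / (1 + T) + q * (1 + T)) +
      1200 / δ ^ 3 * (‖μ‖ * P / (1 + T) + q * (1 + T)) := by ring
  linarith

open Finset in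
lemma g_eq_sum_range {δ P : ℝ} (hδ : 0 ≤ δ) (hP : 0 ≤ P) (θ : ℝ) :
    g δ P θ = ∑ i ∈ range (⌊P⌋₊ - ⌊δ * P⌋₊),
      e (θ * ((⌊δ * P⌋₊ + 1 + i : ℕ) : ℝ) ^ 4) := by
  have h1 : (Icc 1 ⌊P⌋₊).filter (fun x : ℕ => δ * P < (x : ℝ)) =
      Ico (⌊δ * P⌋₊ + 1) (⌊P⌋₊ + 1) := by
    ext x
    rw [mem_filter, mem_Icc, mem_Ico, ← Nat.floor_lt (by positivity)]
    omega
  unfold g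
  rw [h1, sum_Ico_eq_sum_range, Nat.add_sub_add_right]

lemma norm_g_le (a₁ : ℤ) (ha₁ : a₁ ≠ 0) {δ : ℝ} (hδ : 0 < δ) (hδ1 : δ ≤ 1) {P : ℝ} (hP : 1 ≤ P)
    (q a : ℕ) [NeZero q] (haq : Nat.gcd a q = 1) (β : ℝ) :
    ‖g δ P (a₁ * (a / q + β))‖ ≤ 1402 / δ ^ 3 * |(a₁ : ℝ)| *
      (√(quarticWeight q) * P / (1 + P ^ 4 * |β|) + q * (1 + P ^ 4 * |β|)) := by
  have hq : 0 < q := Nat.pos_of_ne_zero (NeZero.ne q)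
  have hq0 : (0 : ℝ) < q := by exact_mod_cast hq
  have hP0 : 0 < P := by linarith
  have ha1 : (1 : ℝ) ≤ |(a₁ : ℝ)| := by exact_mod_cast Int.one_le_abs ha₁
  set w : ℕ → ℂ := fun x => e (((a₁ * a : ℤ) : ℝ) * (x : ℝ) ^ 4 / q) with hw
  have hwper : ∀ x, w (x + q) = w x := by
    intro x
    simp only [hw]
    rw [e_quartic_eq_stdAddChar, e_quartic_eq_stdAddChar]
    simp
  set γ : ℝ := a₁ * β with hγ
  have hfl : ⌊δ * P⌋₊ ≤ ⌊P⌋₊ := Nat.floor_mono (by nlinarith)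
  have h1 := norm_sum_periodic_mul_e_quartic_le w q hq hwper (fun x => (norm_e _).le) hδ hδ1 hP γ
    (⌊δ * P⌋₊ + 1) (⌊P⌋₊ - ⌊δ * P⌋₊) (by omega)
    (by push_cast; exact (Nat.lt_floor_add_one _).le)
    (by
      have h2 : (⌊P⌋₊ : ℝ) ≤ P := Nat.floor_le hP0.le
      have h3 : ((⌊δ * P⌋₊ + 1 : ℕ) : ℝ) + ((⌊P⌋₊ - ⌊δ * P⌋₊ : ℕ) : ℝ) = ⌊P⌋₊ + 1 := by
        rw [← Nat.cast_add]
        exact_mod_cast (by omega : ⌊δ * P⌋₊ + 1 + (⌊P⌋₊ - ⌊δ * P⌋₊) = ⌊P⌋₊ + 1)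
      linarith)
  have h4 : g δ P (a₁ * (a / q + β)) = ∑ i ∈ Finset.range (⌊P⌋₊ - ⌊δ * P⌋₊),
      e (γ * ((⌊δ * P⌋₊ + 1 + i : ℕ) : ℝ) ^ 4) * w (⌊δ * P⌋₊ + 1 + i) := by
    rw [g_eq_sum_range hδ.le hP0.le]
    refine Finset.sum_congr rfl fun i _ => ?_
    simp only [hw]
    rw [← e_add]
    congr 1
    rw [hγ]
    push_cast
    ring
  rw [← h4] at h1
  have hunit : IsUnit ((a : ℤ) : ZMod q) := by
    rw [Int.cast_natCast, ZMod.isUnit_iff_coprime]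
    exact haq
  have hμ : ‖(∑ j ∈ Finset.range q, w j) / q‖ ≤ |(a₁ : ℝ)| * √(quarticWeight q) := by
    have h5 : ∑ j ∈ Finset.range q, w j = quarticSum q (a₁ * a) := rfl
    have h6 := norm_quarticSum_sq_le q a₁ ha₁ a hunit
    rw [h5, norm_div, Complex.norm_natCast, div_le_iff₀ hq0]
    refine abs_le_of_sq_le_sq' ?_ (by positivity) |>.2
    rw [mul_pow, mul_pow, Real.sq_sqrt (quarticWeight_nonneg q)]
    refine h6.trans ?_
    have h7 : |(a₁ : ℝ)| ≤ |(a₁ : ℝ)| ^ 2 := by nlinarith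
    calc |(a₁ : ℝ)| * q ^ 2 * quarticWeight q ≤ |(a₁ : ℝ)| ^ 2 * q ^ 2 * quarticWeight q := by
          have := quarticWeight_nonneg q
          gcongr
      _ = _ := by ring
  have hγa : |γ| = |(a₁ : ℝ)| * |β| := by rw [hγ, abs_mul]
  have hT : P ^ 4 * |γ| = |(a₁ : ℝ)| * (P ^ 4 * |β|) := by rw [hγa]; ring
  set T := P ^ 4 * |β| with hTd
  have hT0 : 0 ≤ T := by positivity
  have hs0 := Real.sqrt_nonneg (quarticWeight q)
  refine h1.trans ?_
  rw [hT, mul_assoc (1402 / δ ^ 3)]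
  refine mul_le_mul_of_nonneg_left ?_ (by positivity)
  rw [mul_add |(a₁ : ℝ)|]
  refine add_le_add ?_ ?_
  · calc _ ≤ |(a₁ : ℝ)| * √(quarticWeight q) * P / (1 + T) := by
          gcongr
          exact le_mul_of_one_le_left hT0 ha1
      _ = _ := by ring
  · calc (q : ℝ) * (1 + |(a₁ : ℝ)| * T) ≤ q * (|(a₁ : ℝ)| * (1 + T)) := by
          gcongr
          nlinarith
      _ = _ := by ring

lemma continuous_e : Continuous e := by
  unfold e
  fun_prop

lemma continuous_h (P R : ℝ) : Continuous (h P R) := by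
  unfold h
  refine continuous_finsetSum _ fun x _ => continuous_e.comp (by fun_prop)

lemma measurableSet_majM (P : ℝ) : MeasurableSet (majM P) := by
  have h1 : majM P = Set.Ico (0:ℝ) 1 ∩ ⋃ q : ℕ, ⋃ a : ℕ, {α : ℝ | 1 ≤ q ∧ (q : ℝ) ≤ P ^ ((1:ℝ)/2) ∧
      a ≤ q ∧ Nat.gcd a q = 1 ∧ |(q : ℝ) * α - (a : ℝ)| ≤ P ^ (-(7:ℝ)/2)} := by
    ext α
    simp [majM]
  rw [h1]
  refine measurableSet_Ico.inter (MeasurableSet.iUnion fun q => MeasurableSet.iUnion fun a => ?_)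
  refine MeasurableSet.const _ |>.inter <| (MeasurableSet.const _).inter <|
    (MeasurableSet.const _).inter <| (MeasurableSet.const _).inter ?_
  exact measurableSet_le (f := fun α : ℝ => |(q : ℝ) * α - (a : ℝ)|) (by fun_prop) measurable_const

lemma norm_g_rpow_le (a₁ : ℤ) (ha₁ : a₁ ≠ 0) {δ : ℝ} (hδ : 0 < δ) (hδ1 : δ ≤ 1) {P : ℝ} (hP : 1 ≤ P)
    (q a : ℕ) [NeZero q] (haq : Nat.gcd a q = 1) (hqP : (q : ℝ) ≤ P ^ ((1:ℝ)/2)) (β : ℝ)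
    (hβ : q * |β| ≤ P ^ (-(7:ℝ)/2)) :
    ‖g δ P (a₁ * (a / q + β))‖ ^ ((9:ℝ)/4) ≤ (4 * (1402 / δ ^ 3 * |(a₁ : ℝ)|)) ^ ((9:ℝ)/4) *
      (quarticWeight q ^ ((9:ℝ)/8) * P ^ ((9:ℝ)/4) * (1 + (P ^ 4 * β) ^ 2)⁻¹ + P ^ ((9:ℝ)/8)) := by
  have hP0 : 0 < P := by linarith
  set K := 1402 / δ ^ 3 * |(a₁ : ℝ)| with hK
  have hK0 : 0 ≤ K := by positivity
  have hf0 := quarticWeight_nonneg q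
  set f := quarticWeight q with hf
  set T := P ^ 4 * |β| with hT
  have hT0 : 0 ≤ T := by positivity
  have h1 : q * (1 + T) ≤ 2 * P ^ ((1:ℝ)/2) := by
    have h2 : q * T ≤ P ^ ((1:ℝ)/2) := by
      calc q * T = P ^ (4:ℝ) * (q * |β|) := by
            rw [hT, show (4:ℝ) = ((4:ℕ):ℝ) by norm_num, Real.rpow_natCast]; ring
        _ ≤ P ^ (4:ℝ) * P ^ (-(7:ℝ)/2) := by gcongr
        _ = _ := by rw [← Real.rpow_add hP0]; norm_num
    linarith
  set X := √f * P / (1 + T) with hX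
  set Y := P ^ ((1:ℝ)/2) with hY
  have hX0 : 0 ≤ X := by positivity
  have hY0 : 0 ≤ Y := by positivity
  have h2 : ‖g δ P (a₁ * (a / q + β))‖ ≤ (4 * K) * max X Y := by
    refine (norm_g_le a₁ ha₁ hδ hδ1 hP q a haq β).trans ?_
    calc K * (X + q * (1 + T)) ≤ K * (max X Y + 2 * max X Y) := by
          refine mul_le_mul_of_nonneg_left (add_le_add (le_max_left _ _) (h1.trans ?_)) hK0
          gcongr
          exact le_max_right _ _
      _ ≤ _ := by nlinarith [mul_nonneg hK0 (hX0.trans (le_max_left X Y))]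
  have h3 : X ^ ((9:ℝ)/4) ≤ f ^ ((9:ℝ)/8) * P ^ ((9:ℝ)/4) * (1 + (P ^ 4 * β) ^ 2)⁻¹ := by
    rw [hX, Real.div_rpow (by positivity) (by positivity), Real.mul_rpow (by positivity) hP0.le,
      Real.sqrt_eq_rpow, ← Real.rpow_mul hf0, div_eq_mul_inv,
      show (1:ℝ)/2 * (9/4) = 9/8 by norm_num]
    gcongr
    have h4 : (1 + T) ^ (2:ℝ) ≤ (1 + T) ^ ((9:ℝ)/4) :=
      Real.rpow_le_rpow_of_exponent_le (by linarith) (by norm_num)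
    refine le_trans ?_ h4
    rw [show (2:ℝ) = ((2:ℕ):ℝ) by norm_num, Real.rpow_natCast]
    have h5 : (P ^ 4 * β) ^ 2 = T ^ 2 := by rw [hT, mul_pow, mul_pow, sq_abs]
    rw [h5]
    nlinarith
  have h4 : Y ^ ((9:ℝ)/4) = P ^ ((9:ℝ)/8) := by
    rw [hY, ← Real.rpow_mul hP0.le]; norm_num
  calc _ ≤ ((4 * K) * max X Y) ^ ((9:ℝ)/4) := by gcongr
    _ = (4 * K) ^ ((9:ℝ)/4) * (max X Y) ^ ((9:ℝ)/4) :=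
        Real.mul_rpow (by positivity) (hX0.trans (le_max_left X Y))
    _ ≤ (4 * K) ^ ((9:ℝ)/4) * (X ^ ((9:ℝ)/4) + Y ^ ((9:ℝ)/4)) := by
        gcongr
        have hX1 : 0 ≤ X ^ ((9:ℝ)/4) := by positivity
        have hY1 : 0 ≤ Y ^ ((9:ℝ)/4) := by positivity
        rcases max_cases X Y with ⟨h, _⟩ | ⟨h, _⟩ <;> rw [h] <;> linarith
    _ ≤ _ := by
        rw [h4]
        gcongr

lemma integrable_comp_sub_mul {W H : ℝ → ℝ} (hW : Integrable W) (hH : Continuous H) {B : ℝ}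
    (hB : ∀ x, |H x| ≤ B) (t : ℝ) : Integrable fun θ => W (θ - t) * H θ :=
  (hW.comp_sub_right t).mul_bdd hH.aestronglyMeasurable (Eventually.of_forall hB)

lemma sum_integral_comp_sub_mul_le {ι : Type*} (s : Finset ι) (t : ι → ℝ) {W H : ℝ → ℝ}
    (hW : Integrable W) (hW0 : ∀ x, 0 ≤ W x) (hH : Continuous H) {B : ℝ} (hB : ∀ x, |H x| ≤ B)
    {M : ℝ} (hM : ∀ β, ∑ a ∈ s, H (β + t a) ≤ M) :
    ∑ a ∈ s, ∫ θ, W (θ - t a) * H θ ≤ M * ∫ β, W β := by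
  have h1 : ∀ a ∈ s, ∫ θ, W (θ - t a) * H θ = ∫ β, W β * H (β + t a) := by
    intro a _
    rw [← integral_sub_right_eq_self (fun β => W β * H (β + t a)) (t a)]
    simp
  have h2 : ∀ a ∈ s, Integrable fun β => W β * H (β + t a) := fun a _ =>
    hW.mul_bdd (by fun_prop) (Eventually.of_forall fun x => hB _)
  rw [Finset.sum_congr rfl h1, ← integral_finsetSum s h2, ← integral_const_mul]
  refine integral_mono (integrable_finsetSum s h2) (hW.const_mul M) fun β => ?_
  simp only
  rw [← Finset.mul_sum, mul_comm]
  exact mul_le_mul_of_nonneg_right (hM β) (hW0 β)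

lemma integral_inv_one_add_mul_sq {c : ℝ} (hc : 0 < c) :
    Integrable (fun β : ℝ => (1 + (c * β) ^ 2)⁻¹) ∧ ∫ β : ℝ, (1 + (c * β) ^ 2)⁻¹ = π / c := by
  refine ⟨integrable_inv_one_add_sq.comp_mul_left' hc.ne', ?_⟩
  rw [Measure.integral_comp_mul_left (fun x : ℝ => (1 + x ^ 2)⁻¹) c, integral_univ_inv_one_add_sq,
    abs_of_pos (by positivity), smul_eq_mul]
  ring

lemma integral_indicator_Icc_neg {c : ℝ} (hc : 0 ≤ c) :
    Integrable ((Set.Icc (-c) c).indicator fun _ => (1:ℝ)) ∧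
      ∫ β, (Set.Icc (-c) c).indicator (fun _ => (1:ℝ)) β = 2 * c := by
  refine ⟨(integrable_indicator_iff measurableSet_Icc).2 (integrableOn_const (by simp)), ?_⟩
  rw [integral_indicator measurableSet_Icc]
  simp [Measure.real, Real.volume_Icc]
  rw [ENNReal.toReal_ofReal (by linarith)]
  ring

/-- A majorant for `‖g(a₁(a/q + β))‖ ^ (9/4)` on the major arc around `a/q`. -/
def arcMajorant (P : ℝ) (q : ℕ) (β : ℝ) : ℝ :=
  quarticWeight q ^ ((9:ℝ)/8) * P ^ ((9:ℝ)/4) * (1 + (P ^ 4 * β) ^ 2)⁻¹ +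
    P ^ ((9:ℝ)/8) * (Set.Icc (-(P ^ (-(7:ℝ)/2) / q)) (P ^ (-(7:ℝ)/2) / q)).indicator (fun _ => (1:ℝ)) β

lemma arcMajorant_nonneg {P : ℝ} (hP : 0 ≤ P) (q : ℕ) (β : ℝ) : 0 ≤ arcMajorant P q β := by
  unfold arcMajorant
  have h1 := quarticWeight_nonneg q
  have h2 : 0 ≤ (Set.Icc (-(P ^ (-(7:ℝ)/2) / q)) (P ^ (-(7:ℝ)/2) / q)).indicator
    (fun _ => (1:ℝ)) β := Set.indicator_nonneg (fun _ _ => zero_le_one) _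
  positivity

lemma integrable_arcMajorant {P : ℝ} (hP : 0 < P) (q : ℕ) : Integrable (arcMajorant P q) :=
  ((integral_inv_one_add_mul_sq (by positivity : 0 < P ^ 4)).1.const_mul _).add
    ((integral_indicator_Icc_neg (by positivity : 0 ≤ P ^ (-(7:ℝ)/2) / q)).1.const_mul _)

lemma continuous_norm_h_pow (A : ℚ) (P R lam : ℝ) :
    Continuous fun θ : ℝ => ‖h P R ((A : ℝ) * θ + lam)‖ ^ 4 :=
  ((continuous_h P R).comp (by fun_prop : Continuous fun θ : ℝ => (A : ℝ) * θ + lam)).norm.pow 4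

lemma abs_norm_h_pow_le {P : ℝ} (hP : 0 ≤ P) (R α : ℝ) : |‖h P R α‖ ^ 4| ≤ P ^ 4 := by
  rw [abs_of_nonneg (by positivity)]
  gcongr
  exact norm_h_le hP R α

lemma sum_integral_arcMajorant_mul_le (A : ℚ) (hA : A ≠ 0) {P : ℝ} (hP : 1 ≤ P) (R lam : ℝ) (q : ℕ)
    [NeZero q] (hqP : (q : ℝ) ≤ P) :
    ∑ a ∈ Finset.range (q + 1), ∫ θ, arcMajorant P q (θ - (a : ℝ) / q) *
        ‖h P R ((A : ℝ) * θ + lam)‖ ^ 4 ≤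
      32 * |(A.num : ℝ)| * A.den * π * P ^ ((9:ℝ)/4) *
        (quarticWeight q ^ ((9:ℝ)/8) * quarticEnergyBound q) + 4 * P ^ ((13:ℝ)/8) := by
  have hP0 : 0 < P := by linarith
  have hq1 : (1 : ℝ) ≤ q := by exact_mod_cast Nat.pos_of_ne_zero (NeZero.ne q)
  set c := P ^ (-(7:ℝ)/2) / q with hc
  have hc0 : 0 ≤ c := by positivity
  set H : ℝ → ℝ := fun θ => ‖h P R ((A : ℝ) * θ + lam)‖ ^ 4 with hH
  have hHc : Continuous H := continuous_norm_h_pow A P R lam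
  have hHb : ∀ x, |H x| ≤ P ^ 4 := fun x => abs_norm_h_pow_le hP0.le R _
  set k := quarticWeight q ^ ((9:ℝ)/8) * P ^ ((9:ℝ)/4) with hk
  have hk0 : 0 ≤ k := by
    have := quarticWeight_nonneg q
    positivity
  set W₁ : ℝ → ℝ := fun β => k * (1 + (P ^ 4 * β) ^ 2)⁻¹ with hW₁
  set W₂ : ℝ → ℝ := fun β => P ^ ((9:ℝ)/8) * (Set.Icc (-c) c).indicator (fun _ => (1:ℝ)) β with hW₂
  have i₁ := integral_inv_one_add_mul_sq (by positivity : 0 < P ^ 4)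
  have i₂ := integral_indicator_Icc_neg hc0
  have hW₁i : Integrable W₁ := i₁.1.const_mul _
  have hW₂i : Integrable W₂ := i₂.1.const_mul _
  have hW₁0 : ∀ x, 0 ≤ W₁ x := fun x => by positivity
  have hW₂0 : ∀ x, 0 ≤ W₂ x := fun x =>
    mul_nonneg (by positivity) (Set.indicator_nonneg (fun _ _ => zero_le_one) _)
  have hsplit : ∀ a ∈ Finset.range (q + 1), ∫ θ, arcMajorant P q (θ - (a : ℝ) / q) * H θ =
      (∫ θ, W₁ (θ - (a : ℝ) / q) * H θ) + ∫ θ, W₂ (θ - (a : ℝ) / q) * H θ := by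
    intro a _
    rw [← integral_add (integrable_comp_sub_mul hW₁i hHc hHb _)
      (integrable_comp_sub_mul hW₂i hHc hHb _)]
    refine integral_congr_ae (Eventually.of_forall fun θ => ?_)
    simp only [arcMajorant, hW₁, hW₂]
    ring
  rw [Finset.sum_congr rfl hsplit, Finset.sum_add_distrib]
  refine add_le_add ?_ ?_
  · refine (sum_integral_comp_sub_mul_le (Finset.range (q + 1)) (fun a => (a : ℝ) / q) hW₁i hW₁0 hHc
      hHb (M := 32 * |(A.num:ℝ)| * A.den * P^4 * quarticEnergyBound q) fun β => ?_).trans_eq ?_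
    · refine le_of_eq_of_le (Finset.sum_congr rfl fun a _ => ?_)
        (sum_norm_h_pow_four_le A hA R q hqP ((A : ℝ) * β + lam))
      simp only [hH]
      ring_nf
    · simp only [hW₁]
      rw [integral_const_mul, i₁.2, hk]
      field_simp
  · refine (sum_integral_comp_sub_mul_le (Finset.range (q + 1)) (fun a => (a : ℝ) / q) hW₂i hW₂0 hHc
      hHb (M := (q + 1) * P ^ 4) fun β => ?_).trans ?_
    · refine (Finset.sum_le_sum fun a _ => (le_abs_self _).trans (hHb _)).trans_eq ?_
      rw [Finset.sum_const, Finset.card_range, nsmul_eq_mul]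
      push_cast
      rfl
    · simp only [hW₂]
      rw [integral_const_mul, i₂.2, hc]
      have h1 : P ^ (4:ℕ) * P ^ ((9:ℝ)/8) * P ^ (-(7:ℝ)/2) = P ^ ((13:ℝ)/8) := by
        rw [← Real.rpow_natCast, ← Real.rpow_add hP0, ← Real.rpow_add hP0]
        norm_num
      calc (q + 1) * P ^ 4 * (P ^ ((9:ℝ)/8) * (2 * (P ^ (-(7:ℝ)/2) / q)))
          = 2 * ((q + 1) / q) * (P ^ (4:ℕ) * P ^ ((9:ℝ)/8) * P ^ (-(7:ℝ)/2)) := by ring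
        _ ≤ 2 * 2 * (P ^ (4:ℕ) * P ^ ((9:ℝ)/8) * P ^ (-(7:ℝ)/2)) := by
            gcongr
            rw [div_le_iff₀ (by linarith)]
            linarith
        _ = _ := by rw [h1]; ring

lemma norm_g_rpow_mul_le (a₁ : ℤ) (ha₁ : a₁ ≠ 0) {δ : ℝ} (hδ : 0 < δ) (hδ1 : δ ≤ 1) {P : ℝ}
    (hP : 1 ≤ P) {H : ℝ → ℝ} (hH : ∀ x, 0 ≤ H x) {θ : ℝ} (hθ : θ ∈ majM P) :
    ‖g δ P ((a₁ : ℝ) * θ)‖ ^ ((9:ℝ)/4) * H θ ≤ (4 * (1402 / δ ^ 3 * |(a₁ : ℝ)|)) ^ ((9:ℝ)/4) *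
      ∑ q ∈ Finset.Icc 1 ⌊P ^ ((1:ℝ)/2)⌋₊, ∑ a ∈ Finset.range (q + 1),
        arcMajorant P q (θ - (a : ℝ) / q) * H θ := by
  have hP0 : 0 < P := by linarith
  obtain ⟨-, q, a, hq, hqP, haq, hgcd, hqa⟩ := hθ
  have : NeZero q := ⟨by omega⟩
  have hq0 : (0 : ℝ) < q := by exact_mod_cast hq
  set β := θ - (a : ℝ) / q with hβ
  have hβq : q * |β| = |(q : ℝ) * θ - a| := by
    rw [← abs_of_pos hq0, ← abs_mul, abs_of_pos hq0, hβ, mul_sub, mul_div_cancel₀ _ hq0.ne']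
  have h1 := norm_g_rpow_le a₁ ha₁ hδ hδ1 hP q a hgcd hqP β (hβq.trans_le hqa)
  have hθβ : (a : ℝ) / q + β = θ := by rw [hβ]; ring
  rw [hθβ] at h1
  have hind : β ∈ Set.Icc (-(P ^ (-(7:ℝ)/2) / q)) (P ^ (-(7:ℝ)/2) / q) := by
    rw [Set.mem_Icc, ← abs_le, le_div_iff₀ hq0, mul_comm]
    exact hβq.trans_le hqa
  have h2 : quarticWeight q ^ ((9:ℝ)/8) * P ^ ((9:ℝ)/4) * (1 + (P ^ 4 * β) ^ 2)⁻¹ + P ^ ((9:ℝ)/8) =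
      arcMajorant P q β := by
    rw [arcMajorant, Set.indicator_of_mem hind, mul_one]
  rw [h2] at h1
  have h0 : ∀ (q a : ℕ), 0 ≤ arcMajorant P q (θ - (a : ℝ) / q) * H θ := fun q a =>
    mul_nonneg (arcMajorant_nonneg hP0.le _ _) (hH _)
  calc _ ≤ ((4 * (1402 / δ ^ 3 * |(a₁ : ℝ)|)) ^ ((9:ℝ)/4) * arcMajorant P q β) * H θ :=
        mul_le_mul_of_nonneg_right h1 (hH θ)
    _ = (4 * (1402 / δ ^ 3 * |(a₁ : ℝ)|)) ^ ((9:ℝ)/4) * (arcMajorant P q β * H θ) := by ring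
    _ ≤ _ := by
        refine mul_le_mul_of_nonneg_left ?_ (by positivity)
        refine le_trans ?_ (Finset.single_le_sum
          (f := fun q : ℕ => ∑ a ∈ Finset.range (q + 1), arcMajorant P q (θ - (a : ℝ) / q) * H θ)
          (fun q _ => Finset.sum_nonneg fun a _ => h0 q a)
          (Finset.mem_Icc.2 ⟨hq, Nat.le_floor hqP⟩))
        exact Finset.single_le_sum (f := fun a : ℕ => arcMajorant P q (θ - (a : ℝ) / q) * H θ)
          (fun a _ => h0 q a) (Finset.mem_range.2 (by omega))

/-- the pruning estimate `J(λ;A) = ∫_𝔐 |g(a₁θ)|^{9/4}|h(Aθ+λ)|⁴ dθ ≪ P^{9/4}`,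
uniformly in `λ ∈ ℝ`. -/
theorem pruning_integral_bound (a₁ : ℤ) (ha₁ : a₁ ≠ 0) (A : ℚ) (hA : A ≠ 0)
    (δ : ℝ) (hδ0 : 0 < δ) (hδ1 : δ < 1) :
    ∃ C : ℝ, ∀ P R : ℝ, 2 ≤ P → 2 ≤ R → R ≤ P → ∀ lam : ℝ,
      (∫ θ in majM P,
          ‖g δ P ((a₁ : ℝ) * θ)‖ ^ ((9:ℝ)/4) * ‖h P R ((A : ℝ) * θ + lam)‖ ^ 4)
        ≤ C * P ^ ((9:ℝ)/4) := by
  obtain ⟨C, hC0, hC⟩ := exists_sum_quarticWeight_le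
  set K := (4 * (1402 / δ ^ 3 * |(a₁ : ℝ)|)) ^ ((9:ℝ)/4) with hK
  have hK0 : 0 ≤ K := by positivity
  set D := 32 * |(A.num : ℝ)| * A.den * π with hD
  have hD0 : 0 ≤ D := by
    have := Real.pi_pos
    positivity
  refine ⟨K * (D * C + 4), fun P R hP _ _ lam => ?_⟩
  have hP1 : 1 ≤ P := by linarith
  have hP0 : 0 < P := by linarith
  set H : ℝ → ℝ := fun θ => ‖h P R ((A : ℝ) * θ + lam)‖ ^ 4 with hH
  have hHc : Continuous H := continuous_norm_h_pow A P R lam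
  have hHb : ∀ x, |H x| ≤ P ^ 4 := fun x => abs_norm_h_pow_le hP0.le R _
  have hH0 : ∀ x, 0 ≤ H x := fun x => by positivity
  set Q := ⌊P ^ ((1:ℝ)/2)⌋₊ with hQ
  set G : ℝ → ℝ := fun θ => ∑ q ∈ Finset.Icc 1 Q, ∑ a ∈ Finset.range (q + 1),
    arcMajorant P q (θ - (a : ℝ) / q) * H θ with hG
  have hterm : ∀ q a : ℕ, Integrable fun θ => arcMajorant P q (θ - (a : ℝ) / q) * H θ := fun q a =>
    integrable_comp_sub_mul (integrable_arcMajorant hP0 q) hHc hHb _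
  have hinner : ∀ q : ℕ, Integrable fun θ => ∑ a ∈ Finset.range (q + 1),
      arcMajorant P q (θ - (a : ℝ) / q) * H θ := fun q =>
    integrable_finsetSum _ fun a _ => hterm q a
  have hGi : Integrable G := integrable_finsetSum _ fun q _ => hinner q
  have hG0 : ∀ θ, 0 ≤ G θ := fun θ => Finset.sum_nonneg fun q _ => Finset.sum_nonneg fun a _ =>
    mul_nonneg (arcMajorant_nonneg hP0.le _ _) (hH0 _)
  have hQP : (Q : ℝ) ≤ P ^ ((1:ℝ)/2) := Nat.floor_le (by positivity)
  have hsqrt : P ^ ((1:ℝ)/2) ≤ P := by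
    simpa using Real.rpow_le_rpow_of_exponent_le hP1 (by norm_num : (1:ℝ)/2 ≤ 1)
  have hGint : ∫ θ, G θ ≤ (D * C + 4) * P ^ ((9:ℝ)/4) := by
    rw [hG, integral_finsetSum _ fun q _ => hinner q]
    have h1 : ∀ q ∈ Finset.Icc 1 Q, ∫ θ, ∑ a ∈ Finset.range (q + 1),
        arcMajorant P q (θ - (a : ℝ) / q) * H θ ≤ D * P ^ ((9:ℝ)/4) *
        (quarticWeight q ^ ((9:ℝ)/8) * quarticEnergyBound q) + 4 * P ^ ((13:ℝ)/8) := by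
      intro q hq
      rw [Finset.mem_Icc] at hq
      have : NeZero q := ⟨by omega⟩
      have hqP : (q : ℝ) ≤ P := by
        have : (q : ℝ) ≤ Q := by exact_mod_cast hq.2
        linarith
      rw [integral_finsetSum _ fun a _ => hterm q a]
      exact sum_integral_arcMajorant_mul_le A hA hP1 R lam q hqP
    refine (Finset.sum_le_sum h1).trans ?_
    rw [Finset.sum_add_distrib, ← Finset.mul_sum, Finset.sum_const, Nat.card_Icc, nsmul_eq_mul,
      Nat.add_sub_cancel]
    have h2 : (Q : ℝ) * (4 * P ^ ((13:ℝ)/8)) ≤ 4 * P ^ ((9:ℝ)/4) := by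
      calc (Q : ℝ) * (4 * P ^ ((13:ℝ)/8)) ≤ P ^ ((1:ℝ)/2) * (4 * P ^ ((13:ℝ)/8)) := by gcongr
        _ = 4 * P ^ ((17:ℝ)/8) := by
            rw [mul_left_comm, ← Real.rpow_add hP0]
            norm_num
        _ ≤ _ := by
            exact mul_le_mul_of_nonneg_left
              (Real.rpow_le_rpow_of_exponent_le hP1 (by norm_num)) (by norm_num)
    have h3 : D * P ^ ((9:ℝ)/4) * ∑ q ∈ Finset.Icc 1 Q,
        quarticWeight q ^ ((9:ℝ)/8) * quarticEnergyBound q ≤ D * P ^ ((9:ℝ)/4) * C := by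
      gcongr
      exact hC Q
    linarith
  calc _ ≤ ∫ θ in majM P, K * G θ := by
        refine integral_mono_of_nonneg (Eventually.of_forall fun θ => by positivity)
          (hGi.const_mul K).integrableOn ?_
        filter_upwards [ae_restrict_mem (measurableSet_majM P)] with θ hθ
        exact norm_g_rpow_mul_le a₁ ha₁ hδ0 hδ1.le hP1 hH0 hθ
    _ ≤ ∫ θ, K * G θ := setIntegral_le_integral (hGi.const_mul K)
        (Eventually.of_forall fun θ => mul_nonneg hK0 (hG0 θ))
    _ = K * ∫ θ, G θ := integral_const_mul _ _
    _ ≤ K * ((D * C + 4) * P ^ ((9:ℝ)/4)) := by gcongr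
    _ = _ := by ring
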